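/- Let u be a time-global classical solution of problem (B) with initial data u0 ∈ C^1([-1,1]) satisfying u0(x) ≥ 1 on [-1,1] and u0'(±1) = ±u0(±1). Then u moves upward to infinity (u(x,t) → ∞ as t → ∞, uniformly in x), and u(x,t+s) − u(0,s) converges, as s → ∞, to φ0(x) + (π/2)·t uniformly, together with its first x-derivative, second x-derivative and first t-derivative, on every compact subset of (-1,1)×ℝ, where φ0(x) := -(2/π)·ln(cos(πx/2)). -/

import Mathlib

open Real

/-- Partial derivative in `x` of a function `u(x,t)`. -/
noncomputable def ux (u : ℝ → ℝ → ℝ) (x t : ℝ) : ℝ := deriv (fun y => u y t) x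

/-- Second partial derivative in `x` of a function `u(x,t)`. -/
noncomputable def uxx (u : ℝ → ℝ → ℝ) (x t : ℝ) : ℝ := deriv (fun y => ux u y t) x

/-- Partial derivative in `t` of a function `u(x,t)`. -/
noncomputable def ut (u : ℝ → ℝ → ℝ) (x t : ℝ) : ℝ := deriv (fun s => u x s) t

/-- A time-global classical solution of problem (B) with initial data `u0`:
`u` and `u_x` are continuous on `[-1,1] × [0,∞)`, `u` is `C^{2,1}` in
`(-1,1) × (0,∞)` where it satisfies `u_t = u_xx/(1+u_x²)`, with boundary
conditions `u_x(±1,t) = ±u(±1,t)` for `t > 0` and initial condition `u(·,0) = u0`. -/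
def IsGlobalSolB (u : ℝ → ℝ → ℝ) (u0 : ℝ → ℝ) : Prop :=
  ContinuousOn (fun p : ℝ × ℝ => u p.1 p.2) (Set.Icc (-1 : ℝ) 1 ×ˢ Set.Ici (0 : ℝ)) ∧
  ContinuousOn (fun p : ℝ × ℝ => ux u p.1 p.2) (Set.Icc (-1 : ℝ) 1 ×ˢ Set.Ici (0 : ℝ)) ∧
  (∀ t > (0 : ℝ), ∀ x ∈ Set.Ioo (-1 : ℝ) 1,
    DifferentiableAt ℝ (fun y => u y t) x ∧
    DifferentiableAt ℝ (fun y => ux u y t) x ∧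
    DifferentiableAt ℝ (fun s => u x s) t ∧
    ut u x t = uxx u x t / (1 + ux u x t ^ 2)) ∧
  (∀ t > (0 : ℝ), ux u 1 t = u 1 t ∧ ux u (-1) t = - u (-1) t) ∧
  (∀ x ∈ Set.Icc (-1 : ℝ) 1, u x 0 = u0 x)

open Set Filter Topology

/-- second derivative test at a local max -/
lemma sd_max {f f' : ℝ → ℝ} {x d : ℝ} (h1 : ∀ᶠ y in 𝓝 x, HasDerivAt f (f' y) y)
    (h2 : HasDerivAt f' d x) (hm : IsLocalMax f x) : f' x = 0 ∧ d ≤ 0 := by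
  have h0 : f' x = 0 := hm.hasDerivAt_eq_zero h1.self_of_nhds
  refine ⟨h0, ?_⟩
  by_contra hd
  push Not at hd
  have e1 : deriv f =ᶠ[𝓝 x] f' := h1.mono fun y hy => hy.deriv
  have e2 : deriv (deriv f) x = d := by
    rw [e1.deriv_eq]; exact h2.deriv
  -- f' > 0 right of x
  have h3 : ∀ᶠ y in 𝓝[>] x, 0 < f' y := by
    have := h2.tendsto_slope
    have h4 : ∀ᶠ y in 𝓝[≠] x, 0 < slope f' x y := this.eventually (lt_mem_nhds hd)
    have h5 : ∀ᶠ y in 𝓝[>] x, 0 < slope f' x y :=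
      h4.filter_mono (nhdsWithin_mono _ fun y hy => ne_of_gt hy)
    filter_upwards [h5, self_mem_nhdsWithin] with y hy hxy
    rw [slope_def_field, h0, sub_zero] at hy
    have : 0 < y - x := sub_pos.2 hxy
    exact (div_pos_iff_of_pos_right this).1 hy
  obtain ⟨ε, hε, hb⟩ := Metric.eventually_nhds_iff.1 (h1.and hm)
  obtain ⟨b, hb1, hb2⟩ := mem_nhdsGT_iff_exists_Ioo_subset.1 h3
  have hxb : x < b := hb1
  set z := min ((x + b)/2) (x + ε/2) with hz
  have hxz : x < z := lt_min (by linarith) (by linarith)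
  have hzb : z < b := lt_of_le_of_lt (min_le_left _ _) (by linarith)
  have hze : z ≤ x + ε/2 := min_le_right _ _
  have hd' : ∀ y ∈ Icc x z, HasDerivAt f (f' y) y := fun y hy =>
    (hb (by rw [Real.dist_eq, abs_lt]; constructor <;> linarith [hy.1, hy.2])).1
  obtain ⟨c, hc, hc2⟩ := exists_hasDerivAt_eq_slope f f' hxz
    (fun y hy => (hd' y hy).continuousAt.continuousWithinAt)
    (fun y hy => hd' y ⟨hy.1.le, hy.2.le⟩)
  have hcp : 0 < f' c := hb2 ⟨hc.1, hc.2.trans hzb⟩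
  have hfz : f z ≤ f x := (hb (by rw [Real.dist_eq, abs_lt]; constructor <;> linarith)).2
  rw [hc2] at hcp
  have : 0 < f z - f x := (div_pos_iff_of_pos_right (sub_pos.2 hxz)).1 hcp
  linarith

/-- left derivative sign in time -/
lemma left_deriv_nonneg {f : ℝ → ℝ} {t d : ℝ} (h : ∀ᶠ s in 𝓝[<] t, f s ≤ f t)
    (hd : HasDerivAt f d t) : 0 ≤ d := by
  have h1 : Tendsto (slope f t) (𝓝[<] t) (𝓝 d) :=
    hd.tendsto_slope.mono_left (nhdsWithin_mono _ fun y hy => ne_of_lt hy)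
  refine ge_of_tendsto h1 ?_
  filter_upwards [h, self_mem_nhdsWithin] with s hs hst
  rw [slope_def_field]
  exact div_nonneg_of_nonpos (by linarith) (by linarith [show s < t from hst])

lemma right_end_max {f f' : ℝ → ℝ} {a b : ℝ} (hab : a < b) (hc : ContinuousOn f (Icc a b))
    (hd : ∀ x ∈ Ioo a b, HasDerivAt f (f' x) x) (hc' : ContinuousWithinAt f' (Icc a b) b)
    (hm : ∀ x ∈ Icc a b, f x ≤ f b) : 0 ≤ f' b := by
  by_contra hn
  push Not at hn
  have h1 : ∀ᶠ y in 𝓝[Icc a b] b, f' y < 0 := hc'.eventually (gt_mem_nhds hn)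
  have h2 : ∀ᶠ y in 𝓝[Ioo a b] b, f' y < 0 := h1.filter_mono (nhdsWithin_mono _ Ioo_subset_Icc_self)
  rw [nhdsWithin_Ioo_eq_nhdsLT hab] at h2
  obtain ⟨c, hc1, hc2⟩ := mem_nhdsLT_iff_exists_Ioo_subset.1 h2
  have hcb : c < b := hc1
  set z := max c ((a+b)/2) with hz
  have hz1 : z < b := max_lt hcb (by linarith)
  have hz2 : a < z := lt_of_lt_of_le (by linarith) (le_max_right _ _)
  obtain ⟨w, hw, hw2⟩ := exists_hasDerivAt_eq_slope f f' hz1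
    (hc.mono (Icc_subset_Icc hz2.le le_rfl)) (fun y hy => hd y ⟨hz2.trans hy.1, hy.2⟩)
  have h3 : f' w < 0 := hc2 ⟨lt_of_le_of_lt (le_max_left _ _) hw.1, hw.2⟩
  have h4 := hm z ⟨hz2.le, hz1.le⟩
  rw [hw2] at h3
  have : 0 ≤ (f b - f z)/(b - z) := div_nonneg (by linarith) (by linarith)
  linarith

lemma left_end_max {f f' : ℝ → ℝ} {a b : ℝ} (hab : a < b) (hc : ContinuousOn f (Icc a b))
    (hd : ∀ x ∈ Ioo a b, HasDerivAt f (f' x) x) (hc' : ContinuousWithinAt f' (Icc a b) a)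
    (hm : ∀ x ∈ Icc a b, f x ≤ f a) : f' a ≤ 0 := by
  have hneg : ∀ x, x ∈ Icc (-b) (-a) → -x ∈ Icc a b := fun x hx => ⟨by linarith [hx.2], by linarith [hx.1]⟩
  have := right_end_max (f := fun x => f (-x)) (f' := fun x => - f' (-x)) (a := -b) (b := -a)
    (by linarith) (hc.comp continuous_neg.continuousOn hneg)
    (fun x hx => by
      have := (hd (-x) ⟨by linarith [hx.2], by linarith [hx.1]⟩).comp x (hasDerivAt_neg x)
      simpa [Function.comp_def] using this)
    (by
      apply ContinuousWithinAt.neg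
      have : ContinuousWithinAt f' (Icc a b) (-(-a)) := by simpa using hc'
      exact this.comp continuous_neg.continuousWithinAt hneg)
    (fun x hx => by simpa using hm _ (hneg x hx))
  simp at this
  exact this

/-- parabolic maximum principle -/
lemma par_max {F Fx Fxx Ft : ℝ → ℝ → ℝ} {a b t0 T : ℝ}
    (hc : ContinuousOn (fun z : ℝ × ℝ => F z.1 z.2) (Icc a b ×ˢ Icc t0 T))
    (hx : ∀ x ∈ Ioo a b, ∀ t ∈ Ioc t0 T, 0 < F x t → HasDerivAt (fun y => F y t) (Fx x t) x)
    (hxx : ∀ x ∈ Ioo a b, ∀ t ∈ Ioc t0 T, 0 < F x t → HasDerivAt (fun y => Fx y t) (Fxx x t) x)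
    (ht : ∀ x ∈ Ioo a b, ∀ t ∈ Ioc t0 T, 0 < F x t → HasDerivAt (fun s => F x s) (Ft x t) t)
    (hInterior : ∀ x ∈ Ioo a b, ∀ t ∈ Ioc t0 T, 0 < F x t → Fx x t = 0 → Fxx x t ≤ 0 → Ft x t < 0)
    (hinit : ∀ x ∈ Icc a b, F x t0 ≤ 0)
    (hbl : ∀ t ∈ Ioc t0 T, 0 < F a t → ¬ ∀ x ∈ Icc a b, F x t ≤ F a t)
    (hbr : ∀ t ∈ Ioc t0 T, 0 < F b t → ¬ ∀ x ∈ Icc a b, F x t ≤ F b t) :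
    ∀ x ∈ Icc a b, ∀ t ∈ Icc t0 T, F x t ≤ 0 := by
  intro x hx0 t ht0
  by_contra hpos
  push Not at hpos
  obtain ⟨⟨y, s⟩, hys, hmax⟩ := (isCompact_Icc.prod isCompact_Icc).exists_isMaxOn
    ⟨(x, t), mk_mem_prod hx0 ht0⟩ hc
  have hM : ∀ x' ∈ Icc a b, ∀ t' ∈ Icc t0 T, F x' t' ≤ F y s := fun x' h1 t' h2 =>
    hmax (mk_mem_prod h1 h2)
  have hy : y ∈ Icc a b := hys.1
  have hs : s ∈ Icc t0 T := hys.2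
  have hp : 0 < F y s := hpos.trans_le (hM x hx0 t ht0)
  have hs0 : t0 < s := by
    rcases hs.1.eq_or_lt with h | h
    · rw [← h] at hp; linarith [hinit y hy]
    · exact h
  have hs' : s ∈ Ioc t0 T := ⟨hs0, hs.2⟩
  have hya : a < y := by
    rcases hy.1.eq_or_lt with h | h
    · exact absurd (fun x' h1 => h ▸ hM x' h1 s hs) (hbl s hs' (h ▸ hp))
    · exact h
  have hyb : y < b := by
    rcases hy.2.eq_or_lt with h | h
    · exact absurd (fun x' h1 => h ▸ hM x' h1 s hs) (hbr s hs' (h ▸ hp))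
    · exact h
  have hy' : y ∈ Ioo a b := ⟨hya, hyb⟩
  have hcy : ContinuousAt (fun y' => F y' s) y := by
    have : ContinuousOn (fun y' => F y' s) (Icc a b) :=
      hc.comp (f := fun y' => (y', s)) (by fun_prop) (fun y' h => mk_mem_prod h hs)
    exact this.continuousAt (Icc_mem_nhds hya hyb)
  have hposn : ∀ᶠ y' in 𝓝 y, 0 < F y' s := hcy.eventually (lt_mem_nhds hp)
  have h1 : ∀ᶠ y' in 𝓝 y, HasDerivAt (fun x' => F x' s) (Fx y' s) y' := by
    filter_upwards [hposn, Ioo_mem_nhds hya hyb] with y' h1 h2 using hx y' h2 s hs' h1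
  obtain ⟨hx0, hxx0⟩ := sd_max h1 (hxx y hy' s hs' hp) (by
    filter_upwards [Ioo_mem_nhds hya hyb] with y' h2
    exact hM y' (Ioo_subset_Icc_self h2) s hs)
  have ht1 : 0 ≤ Ft y s := left_deriv_nonneg (f := fun s' => F y s') (by
    filter_upwards [Ioo_mem_nhdsLT hs0] with s' h2
    exact hM y hy s' ⟨h2.1.le, h2.2.le.trans hs.2⟩) (ht y hy' s hs' hp)
  linarith [hInterior y hy' s hs' hp hx0 hxx0]

structure Sol (u p e : ℝ → ℝ → ℝ) : Prop where
  cu : ContinuousOn (fun z : ℝ × ℝ => u z.1 z.2) (Icc (-1 : ℝ) 1 ×ˢ Ici (0 : ℝ))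
  cp : ContinuousOn (fun z : ℝ × ℝ => p z.1 z.2) (Icc (-1 : ℝ) 1 ×ˢ Ici (0 : ℝ))
  dx : ∀ t > (0:ℝ), ∀ x ∈ Ioo (-1 : ℝ) 1, HasDerivAt (fun y => u y t) (p x t) x
  dxx : ∀ t > (0:ℝ), ∀ x ∈ Ioo (-1 : ℝ) 1, HasDerivAt (fun y => p y t) (e x t) x
  dt : ∀ t > (0:ℝ), ∀ x ∈ Ioo (-1 : ℝ) 1, HasDerivAt (fun s => u x s) (e x t / (1 + p x t ^ 2)) t
  bp : ∀ t > (0:ℝ), p 1 t = u 1 t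
  bm : ∀ t > (0:ℝ), p (-1) t = - u (-1) t

lemma Sol.of {u u0} (h : IsGlobalSolB u u0) : Sol u (ux u) (uxx u) := by
  obtain ⟨h1, h2, h3, h4, h5⟩ := h
  refine ⟨h1, h2, fun t ht x hx => (h3 t ht x hx).1.hasDerivAt,
    fun t ht x hx => (h3 t ht x hx).2.1.hasDerivAt, fun t ht x hx => ?_, fun t ht => (h4 t ht).1,
    fun t ht => (h4 t ht).2⟩
  obtain ⟨_, _, a, b⟩ := h3 t ht x hx
  rw [← b]; exact a.hasDerivAt

section
variable {u p e : ℝ → ℝ → ℝ}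

lemma Sol.cux (S : Sol u p e) {t : ℝ} (ht : 0 ≤ t) : ContinuousOn (fun x => u x t) (Icc (-1) 1) :=
  S.cu.comp (f := fun x => (x, t)) (by fun_prop) (fun x h => mk_mem_prod h ht)
lemma Sol.cpx (S : Sol u p e) {t : ℝ} (ht : 0 ≤ t) : ContinuousOn (fun x => p x t) (Icc (-1) 1) :=
  S.cp.comp (f := fun x => (x, t)) (by fun_prop) (fun x h => mk_mem_prod h ht)
lemma Sol.cut (S : Sol u p e) {x : ℝ} (hx : x ∈ Icc (-1:ℝ) 1) : ContinuousOn (fun t => u x t) (Ici 0) :=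
  S.cu.comp (f := fun t => (x, t)) (by fun_prop) (fun t h => mk_mem_prod hx h)
lemma Sol.cpt (S : Sol u p e) {x : ℝ} (hx : x ∈ Icc (-1:ℝ) 1) : ContinuousOn (fun t => p x t) (Ici 0) :=
  S.cp.comp (f := fun t => (x, t)) (by fun_prop) (fun t h => mk_mem_prod hx h)

/-- comparison with `K + B x² + c t` -/
lemma Sol.comp (S : Sol u p e) {K B c T : ℝ} (hc : c * (1 + 4 * B^2) ≤ 2 * B) (hc0 : 0 ≤ c)
    (h0 : ∀ x ∈ Icc (-1:ℝ) 1, K + B * x^2 ≤ u x 0)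
    (h1 : ∀ t ∈ Ioc 0 T, 2 * B < u 1 t) (h2 : ∀ t ∈ Ioc 0 T, 2 * B < u (-1) t) :
    ∀ x ∈ Icc (-1:ℝ) 1, ∀ t ∈ Icc 0 T, K + B * x^2 + c * t ≤ u x t := by
  have key : ∀ η > 0, ∀ x ∈ Icc (-1:ℝ) 1, ∀ t ∈ Icc 0 T, K + B * x^2 + c * t - η * t - u x t ≤ 0 := by
    intro η hη
    refine par_max (F := fun x t => K + B * x^2 + c * t - η * t - u x t)
      (Fx := fun x t => 2 * B * x - p x t) (Fxx := fun x t => 2 * B - e x t)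
      (Ft := fun x t => c - η - e x t / (1 + p x t ^2)) ?_ ?_ ?_ ?_ ?_ ?_ ?_ ?_
    · have := S.cu.mono (show Icc (-1:ℝ) 1 ×ˢ Icc 0 T ⊆ Icc (-1 : ℝ) 1 ×ˢ Ici (0 : ℝ) from
        prod_mono le_rfl fun t ht => ht.1)
      exact ContinuousOn.sub (by fun_prop) this
    · intro x hx t ht _
      have := (((hasDerivAt_pow 2 x).const_mul B).const_add K |>.add_const (c * t) |>.sub_const (η*t)).fun_sub
        (S.dx t ht.1 x hx)
      exact this.congr_deriv (by norm_num; ring)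
    · intro x hx t ht _
      have := ((hasDerivAt_id' x).const_mul (2*B)).fun_sub (S.dxx t ht.1 x hx)
      simpa using this
    · intro x hx t ht _
      have := ((((hasDerivAt_id' t).const_mul c).const_add (K + B * x^2)).fun_sub
        ((hasDerivAt_id' t).const_mul η)).fun_sub (S.dt t ht.1 x hx)
      simpa using this
    · intro x hx t ht _ e1 e2
      have hpx : p x t = 2 * B * x := by linarith
      have hpos : 0 < 1 + p x t ^2 := by positivity
      have hx2 : x^2 ≤ 1 := by nlinarith [hx.1, hx.2]
      have h4 : c * (1 + p x t ^2) ≤ e x t := by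
        have : p x t ^2 ≤ 4 * B^2 := by rw [hpx]; nlinarith [sq_nonneg B]
        nlinarith
      have : c ≤ e x t / (1 + p x t ^2) := by rw [le_div_iff₀ hpos]; exact h4
      show c - η - e x t / (1 + p x t ^2) < 0
      linarith
    · intro x hx
      have := h0 x hx
      simp only [mul_zero]; linarith
    · intro t ht _ hm
      have := left_end_max (f := fun x => K + B * x^2 + c * t - η * t - u x t)
        (f' := fun x => 2 * B * x - p x t) (by norm_num : (-1:ℝ) < 1)
        (ContinuousOn.sub (by fun_prop) (S.cux ht.1.le))
        (fun x hx => by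
          have := (((hasDerivAt_pow 2 x).const_mul B).const_add K |>.add_const (c * t) |>.sub_const (η*t)).fun_sub
            (S.dx t ht.1 x hx)
          exact this.congr_deriv (by norm_num; ring))
        (((continuousOn_id.const_smul (2*B)).sub (S.cpx ht.1.le)) (-1) (by norm_num)) hm
      have h3 := h2 t ht
      rw [S.bm t ht.1] at this
      linarith
    · intro t ht _ hm
      have := right_end_max (f := fun x => K + B * x^2 + c * t - η * t - u x t)
        (f' := fun x => 2 * B * x - p x t) (by norm_num : (-1:ℝ) < 1)
        (ContinuousOn.sub (by fun_prop) (S.cux ht.1.le))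
        (fun x hx => by
          have := (((hasDerivAt_pow 2 x).const_mul B).const_add K |>.add_const (c * t) |>.sub_const (η*t)).fun_sub
            (S.dx t ht.1 x hx)
          exact this.congr_deriv (by norm_num; ring))
        (((continuousOn_id.const_smul (2*B)).sub (S.cpx ht.1.le)) (1) (by norm_num)) hm
      have h3 := h1 t ht
      rw [S.bp t ht.1] at this
      linarith
  intro x hx t ht
  have h3 : ∀ η > 0, K + B * x^2 + c * t ≤ u x t + η := by
    intro η hη
    have h4 := key (η / (t + 1)) (div_pos hη (by linarith [ht.1])) x hx t ht
    have : η / (t+1) * t ≤ η := by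
      rw [div_mul_eq_mul_div, div_le_iff₀ (by linarith [ht.1])]; nlinarith
    linarith
  exact le_of_forall_pos_le_add h3

lemma Sol.ge_one (S : Sol u p e) (h0 : ∀ x ∈ Icc (-1:ℝ) 1, 1 ≤ u x 0) :
    ∀ x ∈ Icc (-1:ℝ) 1, ∀ t, 0 ≤ t → 1 ≤ u x t := by
  have main : ∀ x ∈ Icc (-1:ℝ) 1, ∀ t, 0 ≤ t → 1/2 < u x t := by
    intro x hx t ht
    by_contra hcon
    push Not at hcon
    set A : Set (ℝ × ℝ) := {z | z ∈ Icc (-1:ℝ) 1 ×ˢ Icc 0 t ∧ u z.1 z.2 ≤ 1/2} with hA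
    have hcA : IsCompact A := by
      have h1 : ContinuousOn (fun z : ℝ × ℝ => u z.1 z.2) (Icc (-1:ℝ) 1 ×ˢ Icc 0 t) :=
        S.cu.mono (prod_mono le_rfl fun t ht => ht.1)
      have := h1.preimage_isClosed_of_isClosed (isClosed_Icc.prod isClosed_Icc) (isClosed_Iic (a := (1/2:ℝ)))
      exact (isCompact_Icc.prod isCompact_Icc).of_isClosed_subset this inter_subset_left
    obtain ⟨⟨y, s⟩, hys, hmin⟩ := hcA.exists_isMinOn (f := fun z : ℝ × ℝ => z.2)
      ⟨(x, t), ⟨mk_mem_prod hx ⟨ht, le_rfl⟩, hcon⟩⟩ (by fun_prop)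
    have hy : y ∈ Icc (-1:ℝ) 1 := hys.1.1
    have hs : s ∈ Icc 0 t := hys.1.2
    have hu : u y s ≤ 1/2 := hys.2
    have hlt : ∀ x' ∈ Icc (-1:ℝ) 1, ∀ t' ∈ Ico 0 s, 1/2 < u x' t' := by
      intro x' h1 t' h2
      by_contra h3
      push Not at h3
      have : s ≤ t' := hmin (show (x', t') ∈ A from ⟨mk_mem_prod h1 ⟨h2.1, h2.2.le.trans hs.2⟩, h3⟩)
      linarith [h2.2]
    have hs0 : 0 < s := by
      rcases hs.1.eq_or_lt with h | h
      · rw [← h] at hu; linarith [h0 y hy]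
      · exact h
    have hle : ∀ x' ∈ Icc (-1:ℝ) 1, ∀ t' ∈ Ioc 0 s, 1/2 ≤ u x' t' := by
      intro x' h1 t' h2
      rcases h2.2.lt_or_eq with h | h
      · exact (hlt x' h1 t' ⟨h2.1.le, h⟩).le
      · subst h
        have : Tendsto (fun r => u x' r) (𝓝[<] t') (𝓝 (u x' t')) :=
          ((S.cut h1).continuousAt (Ici_mem_nhds h2.1)).tendsto.mono_left nhdsWithin_le_nhds
        refine ge_of_tendsto this ?_
        filter_upwards [Ioo_mem_nhdsLT h2.1] with r hr
        exact (hlt x' h1 r ⟨hr.1.le, hr.2⟩).le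
    have := S.comp (K := 1) (B := 0) (c := 0) (T := s) (by norm_num) le_rfl (by simpa using h0)
      (fun t' h => by linarith [hle 1 (by norm_num) t' h]) (fun t' h => by linarith [hle (-1) (by norm_num) t' h])
      y hy s ⟨hs0.le, le_rfl⟩
    linarith
  intro x hx t ht
  have := S.comp (K := 1) (B := 0) (c := 0) (T := t) (by norm_num) le_rfl (by simpa using h0)
      (fun t' h => by linarith [main 1 (by norm_num) t' h.1.le]) (fun t' h => by linarith [main (-1) (by norm_num) t' h.1.le])
      x hx t ⟨ht, le_rfl⟩
  linarith

lemma Sol.growth (S : Sol u p e) (h0 : ∀ x ∈ Icc (-1:ℝ) 1, 1 ≤ u x 0) :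
    ∀ x ∈ Icc (-1:ℝ) 1, ∀ t, 0 ≤ t → 3/4 + 2/5 * t ≤ u x t := by
  intro x hx t ht
  have := S.comp (K := 3/4) (B := 1/4) (c := 2/5) (T := t) (by norm_num) (by norm_num)
    (fun x hx => by have := h0 x hx; nlinarith [hx.1, hx.2])
    (fun t' h => by linarith [S.ge_one h0 1 (by norm_num) t' h.1.le])
    (fun t' h => by linarith [S.ge_one h0 (-1) (by norm_num) t' h.1.le]) x hx t ⟨ht, le_rfl⟩
  nlinarith [sq_nonneg x]
end

open Set Filter Topology

lemma abs_arctan_le {x L : ℝ} (h : |x| ≤ L) : -Real.arctan L ≤ Real.arctan x ∧ Real.arctan x ≤ Real.arctan L := by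
  rw [abs_le] at h
  refine ⟨?_, Real.arctan_strictMono.monotone h.2⟩
  rw [← Real.arctan_neg]; exact Real.arctan_strictMono.monotone h.1

lemma tan_clamp_cont {c : ℝ} (hc : c < Real.pi / 2) (hc0 : 0 ≤ c) {Λ : ℝ → ℝ} (h : Continuous Λ) :
    Continuous fun x => Real.tan (max (-c) (min c (Λ x))) := by
  rw [continuous_iff_continuousAt]
  intro x
  have h1 : ContinuousAt (fun x => max (-c) (min c (Λ x))) x := by fun_prop
  refine ContinuousAt.comp (f := fun x => max (-c) (min c (Λ x))) (g := Real.tan) ?_ h1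
  apply Real.continuousAt_tan.2
  apply ne_of_gt
  apply Real.cos_pos_of_mem_Ioo
  constructor
  · exact lt_of_lt_of_le (by linarith) (le_max_left _ _)
  · exact lt_of_le_of_lt (max_le (by linarith) (min_le_left _ _)) hc

lemma spatial {f d : ℝ → ℝ} {k k' : ℝ → ℝ → ℝ} {k2 : ℝ → ℝ} {a b L : ℝ} (hab : a < b)
    (hf : ContinuousOn f (Icc a b)) (hd : Continuous d)
    (hk : ∀ x ∈ Icc a b, ∀ y ∈ Icc a b, k x y ≤ f y) (hkx : ∀ x ∈ Icc a b, k x x = f x)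
    (hk1 : ∀ x ∈ Icc a b, ∀ y ∈ Icc a b, HasDerivAt (k x) (k' x y) y)
    (hk2 : ∀ x ∈ Icc a b, HasDerivAt (k' x) (k2 x) x) (hL : ∀ x ∈ Icc a b, |k' x x| ≤ L)
    (hdk : ∀ x ∈ Icc a b, d x ≤ k2 x / (1 + (k' x x)^2)) :
    ∫ x in a..b, d x ≤ Real.arctan (k' b b) - Real.arctan (k' a a) := by
  by_contra hcon
  push Not at hcon
  have ha : a ∈ Icc a b := ⟨le_rfl, hab.le⟩
  have hb : b ∈ Icc a b := ⟨hab.le, le_rfl⟩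
  set θa := Real.arctan (k' a a)
  set θb := Real.arctan (k' b b)
  set γ := (∫ x in a..b, d x) - (θb - θa) with hγ
  have hγ0 : 0 < γ := by linarith
  have hba : 0 < b - a := by linarith
  obtain ⟨δ, hδ⟩ : ∃ δ, δ = γ / (4 * (b - a)) := ⟨_, rfl⟩
  have hδ0 : 0 < δ := by rw [hδ]; positivity
  have hδ1 : δ * (b - a) = γ / 4 := by rw [hδ]; field_simp
  set Λ : ℝ → ℝ := fun x => (θa - γ/4) + (∫ y in a..x, d y) - δ * (x - a) with hΛ
  have hΛd : ∀ x, HasDerivAt Λ (d x - δ) x := by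
    intro x
    have h1 := (hd.integral_hasStrictDerivAt a x).hasDerivAt
    have h2 := (h1.const_add (θa - γ/4)).fun_sub (((hasDerivAt_id' x).sub_const a).const_mul δ)
    simpa using h2
  have hΛc : Continuous Λ := continuous_iff_continuousAt.2 fun x => (hΛd x).continuousAt
  have hL0 : 0 ≤ L := (abs_nonneg _).trans (hL a ha)
  have hA0 : 0 ≤ Real.arctan L := by
    have := Real.arctan_strictMono.monotone hL0; simpa using this
  have hA1 : Real.arctan L < Real.pi/2 := Real.arctan_lt_pi_div_two L
  obtain ⟨c, hc⟩ : ∃ c, c = (Real.arctan L + Real.pi/2)/2 := ⟨_, rfl⟩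
  have hc1 : Real.arctan L < c := by linarith
  have hc2 : c < Real.pi/2 := by linarith
  set cl : ℝ → ℝ := fun x => max (-c) (min c (Λ x)) with hcl
  set g' : ℝ → ℝ := fun x => Real.tan (cl x) with hg'
  have hg'c : Continuous g' := tan_clamp_cont hc2 (by linarith) hΛc
  have hclm : ∀ x, cl x ∈ Ioo (-(Real.pi/2)) (Real.pi/2) := fun x =>
    ⟨lt_of_lt_of_le (by linarith) (le_max_left _ _), lt_of_le_of_lt (max_le (by linarith) (min_le_left _ _)) hc2⟩
  have harc : ∀ x, Real.arctan (g' x) = cl x := fun x => Real.arctan_tan (hclm x).1 (hclm x).2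
  set g : ℝ → ℝ := fun x => ∫ y in a..x, g' y with hg
  have hgd : ∀ x, HasDerivAt g (g' x) x := fun x => (hg'c.integral_hasStrictDerivAt a x).hasDerivAt
  have hgc : Continuous g := continuous_iff_continuousAt.2 fun x => (hgd x).continuousAt
  obtain ⟨x, hx, hmax⟩ := isCompact_Icc.exists_isMaxOn (nonempty_Icc.2 hab.le) (hf.sub hgc.continuousOn)
  have hmx : ∀ y ∈ Icc a b, k x y - g y ≤ k x x - g x := by
    intro y hy
    have h1 : f y - g y ≤ f x - g x := hmax hy
    rw [hkx x hx]; linarith [hk x hx y hy]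
  have hkd : ∀ y ∈ Icc a b, HasDerivAt (fun y => k x y - g y) (k' x y - g' y) y := fun y hy =>
    (hk1 x hx y hy).fun_sub (hgd y)
  have hkc : ContinuousOn (fun y => k x y - g y) (Icc a b) := fun y hy =>
    (hkd y hy).continuousAt.continuousWithinAt
  have hkc' : ContinuousWithinAt (fun y => k' x y - g' y) (Icc a b) x :=
    ((hk2 x hx).continuousAt.sub hg'c.continuousAt).continuousWithinAt
  have hxa : a < x := by
    rcases hx.1.eq_or_lt with h | h
    · exfalso
      subst h
      have h1 := left_end_max hab hkc (fun y hy => hkd y (Ioo_subset_Icc_self hy)) hkc' hmx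
      have h2 : Real.arctan (k' a a) ≤ Real.arctan (g' a) := Real.arctan_strictMono.monotone (by linarith)
      rw [harc] at h2
      have h3 : Λ a = θa - γ/4 := by simp [hΛ]
      have h4 := (abs_arctan_le (hL a ha)).1
      have h5 : cl a < θa := by
        simp only [hcl, h3]
        apply max_lt
        · linarith
        · exact lt_of_le_of_lt (min_le_right _ _) (by linarith)
      linarith
    · exact h
  have hxb : x < b := by
    rcases hx.2.eq_or_lt with h | h
    · exfalso
      subst h
      have h1 := right_end_max hab hkc (fun y hy => hkd y (Ioo_subset_Icc_self hy)) hkc' hmx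
      have h2 : Real.arctan (g' x) ≤ Real.arctan (k' x x) := Real.arctan_strictMono.monotone (by linarith)
      rw [harc] at h2
      have h3 : Λ x = θb + γ/2 := by simp only [hΛ]; linarith
      have h4 := (abs_arctan_le (hL x hx)).2
      have h5 : θb < cl x := by
        simp only [hcl, h3]
        apply lt_max_of_lt_right
        apply lt_min
        · linarith
        · linarith
      linarith
    · exact h
  have hlm : IsLocalMax (fun y => k x y - g y) x := by
    filter_upwards [Ioo_mem_nhds hxa hxb] with y hy using hmx y (Ioo_subset_Icc_self hy)
  have h0 : k' x x = g' x := by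
    have := hlm.hasDerivAt_eq_zero (hkd x hx); linarith
  have hcx : cl x = Real.arctan (k' x x) := by rw [h0, harc]
  have hb1 := abs_arctan_le (hL x hx)
  have hΛx : -c < Λ x ∧ Λ x < c := by
    rw [← hcx] at hb1
    constructor
    · by_contra h
      push Not at h
      have : cl x = -c := by simp only [hcl]; rw [min_eq_right (by linarith), max_eq_left h]
      linarith
    · by_contra h
      push Not at h
      have : cl x = c := by simp only [hcl]; rw [min_eq_left h, max_eq_right (by linarith)]
      linarith
  have hev : g' =ᶠ[𝓝 x] fun y => Real.tan (Λ y) := by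
    filter_upwards [hΛc.continuousAt.eventually (lt_mem_nhds hΛx.1), hΛc.continuousAt.eventually (gt_mem_nhds hΛx.2)] with y h1 h2
    simp only [hg', hcl]
    rw [min_eq_right h2.le, max_eq_right h1.le]
  have hgx : g' x = Real.tan (Λ x) := hev.self_of_nhds
  have hcos : 0 < Real.cos (Λ x) := Real.cos_pos_of_mem_Ioo ⟨by linarith, by linarith⟩
  have hg2 : HasDerivAt g' ((1 + g' x ^2) * (d x - δ)) x := by
    have h1 := (Real.hasDerivAt_tan hcos.ne').comp x (hΛd x)
    have h2 := h1.congr_of_eventuallyEq hev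
    refine h2.congr_deriv ?_
    rw [hgx, Real.tan_eq_sin_div_cos]
    have := Real.sin_sq_add_cos_sq (Λ x)
    field_simp
    linear_combination (-(d x - δ)) * this
  have h9 := (sd_max (f := fun y => k x y - g y) (f' := fun y => k' x y - g' y)
    (by filter_upwards [Ioo_mem_nhds hxa hxb] with y hy using hkd y (Ioo_subset_Icc_self hy))
    ((hk2 x hx).fun_sub hg2) hlm).2
  have h10 := hdk x hx
  have hpos : 0 < 1 + k' x x ^2 := by positivity
  rw [le_div_iff₀ hpos] at h10
  rw [← h0] at h9
  nlinarith

open Set Filter Topology MeasureTheory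

lemma telescope {M : ℝ → ℝ} {t1 t2 h0 κ : ℝ} (h12 : t1 ≤ t2) (hh0 : 0 < h0)
    (h : ∀ t h, 0 < h → h ≤ h0 → t1 ≤ t → t + h ≤ t2 → M (t + h) - M t ≤ κ * h) :
    M t2 - M t1 ≤ κ * (t2 - t1) := by
  rcases h12.eq_or_lt with he | hlt
  · subst he; simp
  obtain ⟨n, hn⟩ := exists_nat_gt ((t2 - t1) / h0)
  have hn0 : (0:ℝ) < n := lt_of_le_of_lt (div_nonneg (by linarith) hh0.le) hn
  set s := (t2 - t1) / n with hs
  have hs0 : 0 < s := div_pos (by linarith) hn0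
  have hns : n * s = t2 - t1 := by rw [hs]; field_simp
  have hsh : s ≤ h0 := by
    rw [hs, div_le_iff₀ hn0]; rw [div_lt_iff₀ hh0] at hn; linarith
  have key : ∀ j : ℕ, j ≤ n → M (t1 + j * s) - M t1 ≤ κ * (j * s) := by
    intro j
    induction j with
    | zero => intro _; simp
    | succ j ih =>
      intro hj
      have h1 := ih (by omega)
      have hj' : ((j:ℝ) + 1) ≤ n := by exact_mod_cast hj
      have h2 := h (t1 + j * s) s hs0 hsh (by nlinarith [Nat.cast_nonneg (α := ℝ) j]) (by nlinarith)
      have e1 : t1 + ((j + 1 : ℕ) : ℝ) * s = t1 + j * s + s := by push_cast; ring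
      rw [e1]
      push_cast
      linarith
  have := key n le_rfl
  rw [hns] at this
  simpa using this

structure Rect (v q e : ℝ → ℝ → ℝ) (a b τ0 τ1 : ℝ) : Prop where
  cv : ContinuousOn (fun z : ℝ × ℝ => v z.1 z.2) (Icc a b ×ˢ Icc τ0 τ1)
  cq : ContinuousOn (fun z : ℝ × ℝ => q z.1 z.2) (Icc a b ×ˢ Icc τ0 τ1)
  dx : ∀ x ∈ Icc a b, ∀ t ∈ Icc τ0 τ1, HasDerivAt (fun y => v y t) (q x t) x
  dxx : ∀ x ∈ Icc a b, ∀ t ∈ Icc τ0 τ1, HasDerivAt (fun y => q y t) (e x t) x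
  dt : ∀ x ∈ Icc a b, ∀ t ∈ Icc τ0 τ1, HasDerivAt (fun s => v x s) (e x t / (1 + q x t ^ 2)) t

lemma Rect.neg {v q e : ℝ → ℝ → ℝ} {a b τ0 τ1 : ℝ} (R : Rect v q e a b τ0 τ1) :
    Rect (fun x t => - v x t) (fun x t => - q x t) (fun x t => - e x t) a b τ0 τ1 := by
  refine ⟨R.cv.neg, R.cq.neg, fun x hx t ht => (R.dx x hx t ht).fun_neg, fun x hx t ht => (R.dxx x hx t ht).fun_neg,
    fun x hx t ht => ?_⟩
  refine (R.dt x hx t ht).fun_neg.congr_deriv ?_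
  rw [neg_sq, neg_div]

/-- uniform continuity in convenient form -/
lemma unif_time {v : ℝ → ℝ → ℝ} {a b τ0 τ1 : ℝ}
    (hv : ContinuousOn (fun z : ℝ × ℝ => v z.1 z.2) (Icc a b ×ˢ Icc τ0 τ1)) {η : ℝ} (hη : 0 < η) :
    ∃ r > 0, ∀ x ∈ Icc a b, ∀ y ∈ Icc a b, ∀ s ∈ Icc τ0 τ1, ∀ t ∈ Icc τ0 τ1, |x - y| < r → |s - t| < r →
      |v x s - v y t| < η := by
  have := (isCompact_Icc.prod isCompact_Icc).uniformContinuousOn_of_continuous hv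
  obtain ⟨r, hr, h⟩ := Metric.uniformContinuousOn_iff.1 this η hη
  refine ⟨r, hr, fun x hx y hy s hs t ht h1 h2 => ?_⟩
  have := h (x, s) (mk_mem_prod hx hs) (y, t) (mk_mem_prod hy ht) (by
    rw [Prod.dist_eq]; exact max_lt (by rwa [Real.dist_eq]) (by rwa [Real.dist_eq]))
  rwa [Real.dist_eq] at this

lemma exists_bound {v : ℝ → ℝ → ℝ} {a b τ0 τ1 : ℝ}
    (hv : ContinuousOn (fun z : ℝ × ℝ => v z.1 z.2) (Icc a b ×ˢ Icc τ0 τ1)) :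
    ∃ B > 0, ∀ x ∈ Icc a b, ∀ t ∈ Icc τ0 τ1, |v x t| ≤ B := by
  obtain ⟨C, hC⟩ := (isCompact_Icc.prod isCompact_Icc).exists_bound_of_continuousOn hv
  refine ⟨max C 1, by positivity, fun x hx t ht => ?_⟩
  exact (hC (x, t) (mk_mem_prod hx ht)).trans (le_max_left _ _)

lemma contx {v : ℝ → ℝ → ℝ} {a b τ0 τ1 t : ℝ}
    (hv : ContinuousOn (fun z : ℝ × ℝ => v z.1 z.2) (Icc a b ×ˢ Icc τ0 τ1)) (ht : t ∈ Icc τ0 τ1) :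
    ContinuousOn (fun x => v x t) (Icc a b) :=
  hv.comp (f := fun x => (x, t)) (by fun_prop) (fun x h => mk_mem_prod h ht)
lemma contt {v : ℝ → ℝ → ℝ} {a b τ0 τ1 x : ℝ}
    (hv : ContinuousOn (fun z : ℝ × ℝ => v z.1 z.2) (Icc a b ×ˢ Icc τ0 τ1)) (hx : x ∈ Icc a b) :
    ContinuousOn (fun t => v x t) (Icc τ0 τ1) :=
  hv.comp (f := fun t => (x, t)) (by fun_prop) (fun x h => mk_mem_prod hx h)

lemma green_le {v q e : ℝ → ℝ → ℝ} {a b τ0 τ1 t1 t2 : ℝ} (R : Rect v q e a b τ0 τ1)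
    (hab : a < b) (h01 : τ0 < t1) (h12 : t1 ≤ t2) (h23 : t2 < τ1) :
    ∫ x in a..b, (v x t2 - v x t1) ≤
      ∫ s in t1..t2, (Real.arctan (q b s) - Real.arctan (q a s)) := by
  have ha : a ∈ Icc a b := ⟨le_rfl, hab.le⟩
  have hb : b ∈ Icc a b := ⟨hab.le, le_rfl⟩
  have cθ : ContinuousOn (fun z : ℝ × ℝ => Real.arctan (q z.1 z.2)) (Icc a b ×ˢ Icc τ0 τ1) :=
    Real.continuous_arctan.comp_continuousOn R.cq
  obtain ⟨B, hB0, hB⟩ := exists_bound R.cv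
  obtain ⟨L, hL0, hL⟩ := exists_bound R.cq
  set Θ : ℝ → ℝ := fun s => Real.arctan (q b s) - Real.arctan (q a s) with hΘ
  have hΘc : ContinuousOn Θ (Icc τ0 τ1) :=
    (contt (v := fun x t => Real.arctan (q x t)) cθ hb).sub (contt (v := fun x t => Real.arctan (q x t)) cθ ha)
  have hΘi : ∀ s t, s ∈ Icc τ0 τ1 → t ∈ Icc τ0 τ1 → IntervalIntegrable Θ volume s t := fun s t hs ht =>
    (hΘc.mono (uIcc_subset_Icc hs ht)).intervalIntegrable
  have ht1 : t1 ∈ Icc τ0 τ1 := ⟨by linarith, by linarith⟩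
  have ht2 : t2 ∈ Icc τ0 τ1 := ⟨by linarith, by linarith⟩
  have main : ∀ η > 0, ∫ x in a..b, (v x t2 - v x t1) ≤ (∫ s in t1..t2, Θ s) + η * ((b - a) + 3 * (t2 - t1)) := by
    intro η hη
    obtain ⟨r1, hr1, hu1⟩ := unif_time R.cv hη
    obtain ⟨r2, hr2, hu2⟩ := unif_time (v := fun x t => Real.arctan (q x t)) cθ hη
    set r := min r1 r2 with hr
    have hr0 : 0 < r := lt_min hr1 hr2
    obtain ⟨m, hm⟩ : ∃ m, m = min (r/3) (min ((t1 - τ0)/2) ((τ1 - t2)/2)) := ⟨_, rfl⟩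
    have hm0 : 0 < m := by
      rw [hm]; exact lt_min (by linarith) (lt_min (by linarith) (by linarith))
    have hmr : m ≤ r/3 := by rw [hm]; exact min_le_left _ _
    have hm1 : m ≤ (t1 - τ0)/2 := by rw [hm]; exact (min_le_right _ _).trans (min_le_left _ _)
    have hm2 : m ≤ (τ1 - t2)/2 := by rw [hm]; exact (min_le_right _ _).trans (min_le_right _ _)
    obtain ⟨ε, hε⟩ : ∃ ε, ε = m^2 / (4 * B) := ⟨_, rfl⟩
    have hε0 : 0 < ε := by rw [hε]; positivity
    have hεB : 4 * B * ε = m^2 := by rw [hε]; field_simp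
    -- maximizers
    have hex : ∀ t x, ∃ s, x ∈ Icc a b → (s ∈ Icc τ0 τ1 ∧ ∀ s' ∈ Icc τ0 τ1,
        v x s' - (t - s')^2/(2*ε) ≤ v x s - (t - s)^2/(2*ε)) := by
      intro t x
      by_cases hx : x ∈ Icc a b
      · obtain ⟨s, hs, hmax⟩ := isCompact_Icc.exists_isMaxOn (nonempty_Icc.2 (by linarith : τ0 ≤ τ1))
          (f := fun s => v x s - (t - s)^2/(2*ε)) ((contt R.cv hx).sub (by fun_prop))
        exact ⟨s, fun _ => ⟨hs, fun s' hs' => hmax hs'⟩⟩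
      · exact ⟨0, fun h => absurd h hx⟩
    choose S hS using hex
    set f : ℝ → ℝ → ℝ := fun t x => v x (S t x) - (t - S t x)^2/(2*ε) with hf
    have hf1 : ∀ t, ∀ x ∈ Icc a b, ∀ s' ∈ Icc τ0 τ1, v x s' - (t - s')^2/(2*ε) ≤ f t x :=
      fun t x hx => (hS t x hx).2
    have hSm : ∀ t ∈ Icc t1 t2, ∀ x ∈ Icc a b, |S t x - t| ≤ m := by
      intro t ht x hx
      have htI : t ∈ Icc τ0 τ1 := ⟨by linarith [ht.1], by linarith [ht.2]⟩
      have h1 := hf1 t x hx t htI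
      have hsI := (hS t x hx).1
      have h2 := abs_le.1 (hB x hx t htI)
      have h3 := abs_le.1 (hB x hx _ hsI)
      simp only [sub_self, hf] at h1
      have h4 : (t - S t x)^2/(2*ε) ≤ 2 * B := by norm_num at h1; linarith
      rw [div_le_iff₀ (by positivity)] at h4
      apply abs_le_of_sq_le_sq _ hm0.le
      nlinarith
    have hfv : ∀ t ∈ Icc t1 t2, ∀ x ∈ Icc a b, v x t ≤ f t x ∧ f t x ≤ v x t + η := by
      intro t ht x hx
      have htI : t ∈ Icc τ0 τ1 := ⟨by linarith [ht.1], by linarith [ht.2]⟩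
      have h1 := hf1 t x hx t htI
      refine ⟨by simpa using h1, ?_⟩
      have hsI := (hS t x hx).1
      have h2 := hu1 x hx x hx _ hsI t htI (by simpa using hr1) (by
        have := hSm t ht x hx
        have : r ≤ r1 := min_le_left _ _
        linarith)
      have h3 := (abs_lt.1 h2).2
      have : 0 ≤ (t - S t x)^2/(2*ε) := by positivity
      simp only [hf]; linarith
    have hfc : ∀ t, ContinuousOn (f t) (Icc a b) := by
      intro t
      rw [Metric.continuousOn_iff]
      intro x hx ε' hε'
      obtain ⟨r', hr', hu'⟩ := unif_time R.cv hε'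
      refine ⟨r', hr', fun y hy hxy => ?_⟩
      rw [Real.dist_eq] at hxy ⊢
      have h1 := hu' y hy x hx _ (hS t y hy).1 _ (hS t y hy).1 hxy (by simpa using hr')
      have h2 := hu' y hy x hx _ (hS t x hx).1 _ (hS t x hx).1 hxy (by simpa using hr')
      have h3 := hf1 t x hx _ (hS t y hy).1
      have h4 := hf1 t y hy _ (hS t x hx).1
      rw [abs_lt] at h1 h2 ⊢
      simp only [hf] at h3 h4 ⊢
      constructor <;> linarith [h1.1, h1.2, h2.1, h2.2]
    have hfi : ∀ t, IntervalIntegrable (f t) volume a b := fun t => by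
      apply ContinuousOn.intervalIntegrable; rw [uIcc_of_le hab.le]; exact hfc t
    -- the one step estimate
    have hba : 0 < b - a := by linarith
    have step : ∀ t h, 0 < h → h ≤ min (r/2) (2*ε*η/(b-a)) → t1 ≤ t → t + h ≤ t2 →
        ((∫ x in a..b, f (t+h) x) - ∫ s in t1..(t+h), Θ s) - ((∫ x in a..b, f t x) - ∫ s in t1..t, Θ s) ≤ (3*η) * h := by
      intro t h hh hh0 htt1 htt2
      have hhr : h ≤ r/2 := hh0.trans (min_le_left _ _)
      have hhe : h ≤ 2*ε*η/(b-a) := hh0.trans (min_le_right _ _)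
      rw [le_div_iff₀ hba] at hhe
      have hth : t + h ∈ Icc t1 t2 := ⟨by linarith, htt2⟩
      have htm : t ∈ Icc t1 t2 := ⟨htt1, by linarith⟩
      set D : ℝ → ℝ := fun x => (f (t+h) x - f t x)/h - h/(2*ε) with hD
      have hDc : ContinuousOn D (Icc a b) := (((hfc _).sub (hfc _)).div_const h).sub continuousOn_const
      set d : ℝ → ℝ := IccExtend hab.le ((Icc a b).domRestrict D) with hd
      have hdc : Continuous d := hDc.domRestrict.Icc_extend'
      have hdD : ∀ x ∈ Icc a b, d x = D x := fun x hx => by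
        rw [hd, IccExtend_of_mem _ _ hx]; rfl
      have hSI : ∀ x ∈ Icc a b, S (t+h) x ∈ Ioo τ0 τ1 := by
        intro x hx
        have := abs_le.1 (hSm _ hth x hx)
        constructor <;> linarith [this.1, this.2]
      have hsp := spatial (f := f (t+h)) (d := d)
        (k := fun x y => v y (S (t+h) x) - (t + h - S (t+h) x)^2/(2*ε))
        (k' := fun x y => q y (S (t+h) x)) (k2 := fun x => e x (S (t+h) x)) (L := L) hab (hfc _) hdc
        (fun x hx y hy => hf1 (t+h) y hy _ (hS (t+h) x hx).1) (fun x hx => rfl)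
        (fun x hx y hy => (R.dx y hy _ (hS (t+h) x hx).1).sub_const _)
        (fun x hx => R.dxx x hx _ (hS (t+h) x hx).1)
        (fun x hx => hL x hx _ (hS (t+h) x hx).1)
        (fun x hx => by
          rw [hdD x hx]
          have hI := hSI x hx
          have h1 := R.dt x hx _ (hS (t+h) x hx).1
          have h2 : HasDerivAt (fun s => v x s - (t + h - s)^2/(2*ε))
              (e x (S (t+h) x) / (1 + q x (S (t+h) x) ^ 2) + (t + h - S (t+h) x)/ε) (S (t+h) x) := by
            have h3 := h1.fun_sub (((((hasDerivAt_id' (S (t+h) x)).const_sub (t+h)).fun_pow 2)).div_const (2*ε))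
            refine h3.congr_deriv ?_
            norm_num
            field_simp
            ring
          have h4 : IsLocalMax (fun s => v x s - (t + h - s)^2/(2*ε)) (S (t+h) x) := by
            filter_upwards [Ioo_mem_nhds hI.1 hI.2] with s hs
            exact hf1 (t+h) x hx s (Ioo_subset_Icc_self hs)
          have h5 := h4.hasDerivAt_eq_zero h2
          have h6 := hf1 t x hx _ (hS (t+h) x hx).1
          have h7 : f (t+h) x - f t x ≤ h * (e x (S (t+h) x) / (1 + q x (S (t+h) x) ^ 2)) + h^2/(2*ε) := by
            have e1 : e x (S (t+h) x) / (1 + q x (S (t+h) x) ^ 2) = -((t + h - S (t+h) x)/ε) := by linarith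
            rw [e1]
            have e2 : f (t+h) x = v x (S (t+h) x) - (t + h - S (t+h) x)^2/(2*ε) := rfl
            rw [e2]
            have e3 : h * -((t + h - S (t+h) x)/ε) + h^2/(2*ε)
              = (t - S (t+h) x)^2/(2*ε) - (t + h - S (t+h) x)^2/(2*ε) := by
              field_simp; ring
            rw [e3]; linarith
          simp only [hD]
          rw [sub_le_iff_le_add, div_le_iff₀ hh]
          refine h7.trans (le_of_eq ?_)
          field_simp)
      -- integrate
      have hInterior : ∫ x in a..b, d x = ((∫ x in a..b, f (t+h) x) - ∫ x in a..b, f t x)/h - (b - a) * (h/(2*ε)) := by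
        have e1 : ∫ x in a..b, d x = ∫ x in a..b, D x := by
          apply intervalIntegral.integral_congr
          intro x hx
          rw [uIcc_of_le hab.le] at hx
          exact hdD x hx
        rw [e1, hD, intervalIntegral.integral_sub (((hfi _).sub (hfi _)).div_const h) (by simp),
          intervalIntegral.integral_div, intervalIntegral.integral_sub (hfi _) (hfi _),
          intervalIntegral.integral_const, smul_eq_mul]
      rw [hInterior] at hsp
      have htI : t ∈ Icc τ0 τ1 := ⟨by linarith, by linarith⟩
      have hthI : t + h ∈ Icc τ0 τ1 := ⟨by linarith, by linarith⟩
      have hT : h * ((Real.arctan (q b (S (t+h) b)) - Real.arctan (q a (S (t+h) a))) - 2 * η) ≤ ∫ s in t..(t+h), Θ s := by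
        have := intervalIntegral.integral_mono_on (a := t) (b := t + h) (μ := volume)
          (f := fun _ => (Real.arctan (q b (S (t+h) b)) - Real.arctan (q a (S (t+h) a))) - 2 * η)
          (g := Θ) (by linarith) (by simp) (hΘi _ _ htI hthI) (by
            intro s hs
            have hsI : s ∈ Icc τ0 τ1 := ⟨by linarith [hs.1], by linarith [hs.2]⟩
            have hrr : r ≤ r2 := min_le_right _ _
            have near : ∀ x ∈ Icc a b, |S (t+h) x - s| < r2 := by
              intro x hx
              have h1 := abs_le.1 (hSm _ hth x hx)
              have h2 : |S (t+h) x - s| < r := by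
                rw [abs_lt]; constructor <;> linarith [h1.1, h1.2, hs.1, hs.2]
              linarith
            have h1 := abs_lt.1 (hu2 b hb b hb _ (hS (t+h) b hb).1 s hsI (by simpa using hr2) (near b hb))
            have h2 := abs_lt.1 (hu2 a ha a ha _ (hS (t+h) a ha).1 s hsI (by simpa using hr2) (near a ha))
            simp only [hΘ]
            linarith [h1.1, h1.2, h2.1, h2.2])
        rw [intervalIntegral.integral_const, smul_eq_mul] at this
        simpa only [add_sub_cancel_left] using this
      have hadd : ∫ s in t1..(t+h), Θ s = (∫ s in t1..t, Θ s) + ∫ s in t..(t+h), Θ s :=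
        (intervalIntegral.integral_add_adjacent_intervals (hΘi _ _ ht1 htI) (hΘi _ _ htI hthI)).symm
      rw [hadd]
      rw [sub_le_iff_le_add, div_le_iff₀ hh] at hsp
      have h8 : (b - a) * (h/(2*ε)) ≤ η := by
        rw [mul_div_assoc', div_le_iff₀ (by positivity)]; linarith
      nlinarith
    have htel := telescope (M := fun t => (∫ x in a..b, f t x) - ∫ s in t1..t, Θ s) (κ := 3*η) h12
      (lt_min (by linarith) (by positivity)) step
    simp only [intervalIntegral.integral_same] at htel
    have hcmp : ∫ x in a..b, (v x t2 - v x t1) ≤ ∫ x in a..b, (f t2 x - f t1 x + η) := by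
      apply intervalIntegral.integral_mono_on hab.le
      · apply ContinuousOn.intervalIntegrable; rw [uIcc_of_le hab.le]
        exact (contx R.cv ht2).sub (contx R.cv ht1)
      · exact ((hfi _).sub (hfi _)).add (by simp)
      · intro x hx
        have h1 := hfv t2 ⟨h12, le_rfl⟩ x hx
        have h2 := hfv t1 ⟨le_rfl, h12⟩ x hx
        linarith [h1.1, h2.2]
    rw [intervalIntegral.integral_add ((hfi _).sub (hfi _)) (by simp), intervalIntegral.integral_sub (hfi _) (hfi _),
      intervalIntegral.integral_const, smul_eq_mul] at hcmp
    nlinarith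
  apply le_of_forall_pos_le_add
  intro η hη
  have hpos : 0 < (b - a) + 3 * (t2 - t1) := by linarith
  have := main (η / ((b - a) + 3 * (t2 - t1))) (by positivity)
  rwa [div_mul_cancel₀ _ hpos.ne'] at this

open Set Filter Topology MeasureTheory

/-- continuous extension from `[-1,1] × [0,∞)` -/
noncomputable def xt (f : ℝ → ℝ → ℝ) (x t : ℝ) : ℝ := f (max (-1) (min 1 x)) (max 0 t)

lemma xt_eq {f : ℝ → ℝ → ℝ} {x t : ℝ} (hx : x ∈ Icc (-1:ℝ) 1) (ht : 0 ≤ t) : xt f x t = f x t := by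
  unfold xt
  rw [min_eq_right hx.2, max_eq_right hx.1, max_eq_right ht]

lemma xt_cont {f : ℝ → ℝ → ℝ}
    (h : ContinuousOn (fun z : ℝ × ℝ => f z.1 z.2) (Icc (-1 : ℝ) 1 ×ˢ Ici (0 : ℝ))) :
    Continuous (fun z : ℝ × ℝ => xt f z.1 z.2) := by
  have := h.comp_continuous (f := fun z : ℝ × ℝ => (max (-1) (min 1 z.1), max 0 z.2)) (by fun_prop)
    (fun z => mk_mem_prod ⟨le_max_left _ _, max_le (by norm_num) (min_le_left _ _)⟩ (le_max_left 0 z.2))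
  exact this

section
variable {u p e : ℝ → ℝ → ℝ}

noncomputable def th (p : ℝ → ℝ → ℝ) (x t : ℝ) : ℝ := Real.arctan (p x t)

lemma Sol.cth (S : Sol u p e) : ContinuousOn (fun z : ℝ × ℝ => th p z.1 z.2) (Icc (-1 : ℝ) 1 ×ˢ Ici (0 : ℝ)) :=
  Real.continuous_arctan.comp_continuousOn S.cp

lemma Sol.cU (S : Sol u p e) : Continuous (fun z : ℝ × ℝ => xt u z.1 z.2) := xt_cont S.cu
lemma Sol.cT (S : Sol u p e) : Continuous (fun z : ℝ × ℝ => xt (th p) z.1 z.2) := xt_cont S.cth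
lemma Sol.cUx (S : Sol u p e) (t : ℝ) : Continuous (fun x => xt u x t) :=
  S.cU.comp (f := fun x => (x, t)) (by fun_prop)
lemma Sol.cTt (S : Sol u p e) (x : ℝ) : Continuous (fun t => xt (th p) x t) :=
  S.cT.comp (f := fun t => (x, t)) (by fun_prop)

lemma Sol.rect (S : Sol u p e) {a b τ0 τ1 : ℝ} (ha : -1 < a) (hb : b < 1) (h0 : 0 < τ0) :
    Rect u p e a b τ0 τ1 := by
  have hsub : Icc a b ×ˢ Icc τ0 τ1 ⊆ Icc (-1 : ℝ) 1 ×ˢ Ici (0 : ℝ) :=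
    prod_mono (Icc_subset_Icc ha.le hb.le) fun t ht => h0.le.trans ht.1
  have hx : ∀ x ∈ Icc a b, x ∈ Ioo (-1:ℝ) 1 := fun x hx => ⟨ha.trans_le hx.1, hx.2.trans_lt hb⟩
  exact ⟨S.cu.mono hsub, S.cp.mono hsub, fun x h t ht => S.dx t (h0.trans_le ht.1) x (hx x h),
    fun x h t ht => S.dxx t (h0.trans_le ht.1) x (hx x h), fun x h t ht => S.dt t (h0.trans_le ht.1) x (hx x h)⟩

lemma Sol.green0 (S : Sol u p e) {a b t1 t2 : ℝ} (ha : -1 < a) (hab : a < b) (hb : b < 1)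
    (h1 : 0 < t1) (h12 : t1 ≤ t2) :
    ∫ x in a..b, (xt u x t2 - xt u x t1) = ∫ s in t1..t2, (xt (th p) b s - xt (th p) a s) := by
  have R := S.rect (τ0 := t1/2) (τ1 := t2 + 1) ha hb (by linarith)
  have e1 := green_le R hab (t1 := t1) (t2 := t2) (by linarith) h12 (by linarith)
  have e2 := green_le R.neg hab (t1 := t1) (t2 := t2) (by linarith) h12 (by linarith)
  have e3 : ∫ x in a..b, (- u x t2 - - u x t1) = - ∫ x in a..b, (u x t2 - u x t1) := by
    rw [← intervalIntegral.integral_neg]; congr 1; ext x; ring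
  have e4 : ∫ s in t1..t2, (Real.arctan (-p b s) - Real.arctan (-p a s)) =
      - ∫ s in t1..t2, (Real.arctan (p b s) - Real.arctan (p a s)) := by
    rw [← intervalIntegral.integral_neg]; congr 1; ext x; simp only [Real.arctan_neg]; ring
  rw [e3, e4] at e2
  have e5 : ∫ x in a..b, (xt u x t2 - xt u x t1) = ∫ x in a..b, (u x t2 - u x t1) := by
    apply intervalIntegral.integral_congr
    intro x hx
    rw [uIcc_of_le hab.le] at hx
    have : x ∈ Icc (-1:ℝ) 1 := ⟨by linarith [hx.1], by linarith [hx.2]⟩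
    simp only [xt_eq this (h1.le.trans h12), xt_eq this h1.le]
  have e6 : ∫ s in t1..t2, (xt (th p) b s - xt (th p) a s) = ∫ s in t1..t2, (Real.arctan (p b s) - Real.arctan (p a s)) := by
    apply intervalIntegral.integral_congr
    intro s hs
    rw [uIcc_of_le h12] at hs
    have hs0 : 0 ≤ s := by linarith [hs.1]
    simp only [xt_eq (f := th p) (show b ∈ Icc (-1:ℝ) 1 from ⟨by linarith, by linarith⟩) hs0, 
      xt_eq (f := th p) (show a ∈ Icc (-1:ℝ) 1 from ⟨by linarith, by linarith⟩) hs0, th]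
  rw [e5, e6]
  linarith

/-- primitive of u -/
noncomputable def II (u : ℝ → ℝ → ℝ) (x t : ℝ) : ℝ := ∫ y in (-1:ℝ)..x, xt u y t

lemma Sol.cII (S : Sol u p e) : Continuous (fun z : ℝ × ℝ => II u z.1 z.2) := by
  have h := intervalIntegral.continuous_parametric_primitive_of_continuous (μ := volume)
    (f := fun t y => xt u y t) (a₀ := -1) (by
      exact S.cU.comp (f := fun z : ℝ × ℝ => (z.2, z.1)) (by fun_prop))
  exact h.comp (f := fun z : ℝ × ℝ => (z.2, z.1)) (by fun_prop)

lemma Sol.dIIx (S : Sol u p e) (x t : ℝ) : HasDerivAt (fun y => II u y t) (xt u x t) x :=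
  ((S.cUx t).integral_hasStrictDerivAt (-1) x).hasDerivAt

lemma Sol.green (S : Sol u p e) {x t1 t2 : ℝ} (hx : x ∈ Icc (-1:ℝ) 1) (h1 : 0 < t1) (h12 : t1 ≤ t2) :
    II u x t2 - II u x t1 = ∫ s in t1..t2, (xt (th p) x s - xt (th p) (-1) s) := by
  set G : ℝ → ℝ := fun x => (II u x t2 - II u x t1) - ∫ s in t1..t2, xt (th p) x s with hG
  have hGc : Continuous G := by
    have h2 : Continuous fun x => ∫ s in t1..t2, xt (th p) x s :=
      intervalIntegral.continuous_parametric_intervalIntegral_of_continuous' (f := fun x s => xt (th p) x s) S.cT t1 t2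
    have h3 : ∀ t, Continuous fun x => II u x t := fun t => S.cII.comp (f := fun x => (x, t)) (by fun_prop)
    exact ((h3 t2).sub (h3 t1)).sub h2
  have hInterior : ∀ y a b, IntervalIntegrable (fun s => xt (th p) y s) volume a b := fun y a b =>
    (S.cTt y).intervalIntegrable a b
  have hInteriorU : ∀ t a b, IntervalIntegrable (fun s => xt u s t) volume a b := fun y a b =>
    (S.cUx y).intervalIntegrable a b
  have hlt : ∀ a ∈ Ioo (-1:ℝ) 1, ∀ b ∈ Ioo (-1:ℝ) 1, a < b → G b = G a := by
    intro a ha b hb hab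
    have := S.green0 ha.1 hab hb.2 h1 h12
    rw [intervalIntegral.integral_sub (hInterior _ _ _) (hInterior _ _ _),
      intervalIntegral.integral_sub (hInteriorU _ _ _) (hInteriorU _ _ _)] at this
    have e1 : ∀ t, II u b t = II u a t + ∫ y in a..b, xt u y t := fun t =>
      (intervalIntegral.integral_add_adjacent_intervals (hInteriorU _ _ _) (hInteriorU _ _ _)).symm
    simp only [hG, e1]
    linarith
  have hcst : EqOn G (fun _ => G 0) (Ioo (-1:ℝ) 1) := by
    intro y hy
    rcases lt_trichotomy y 0 with h | h | h
    · exact (hlt y hy 0 (by norm_num) h).symm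
    · rw [h]
    · exact hlt 0 (by norm_num) y hy h
  have hcl : EqOn G (fun _ => G 0) (Icc (-1:ℝ) 1) := by
    have := hcst.of_subset_closure (t := Icc (-1:ℝ) 1) hGc.continuousOn continuousOn_const Ioo_subset_Icc_self
      (by rw [closure_Ioo (by norm_num)])
    exact this
  have e1 := hcl hx
  have e2 := hcl (show (-1:ℝ) ∈ Icc (-1:ℝ) 1 by norm_num)
  have e3 : ∀ t, II u (-1) t = 0 := fun t => by simp [II]
  simp only [hG, e3] at e1 e2
  rw [intervalIntegral.integral_sub (hInterior _ _ _) (hInterior _ _ _)]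
  linarith

lemma Sol.dIIt (S : Sol u p e) {x t : ℝ} (hx : x ∈ Icc (-1:ℝ) 1) (ht : 0 < t) :
    HasDerivAt (fun s => II u x s) (th p x t - th p (-1) t) t := by
  have hc : Continuous fun s => xt (th p) x s - xt (th p) (-1) s := (S.cTt x).sub (S.cTt (-1))
  have h1 := (hc.integral_hasStrictDerivAt (t/2) t).hasDerivAt
  have h2 := h1.const_add (II u x (t/2))
  rw [xt_eq hx ht.le, xt_eq (by norm_num) ht.le] at h2
  refine h2.congr_of_eventuallyEq ?_
  filter_upwards [Ioi_mem_nhds (show t/2 < t by linarith)] with s hs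
  have := S.green hx (show 0 < t/2 by linarith) (le_of_lt hs)
  linarith

lemma Sol.dUx (S : Sol u p e) {x t : ℝ} (hx : x ∈ Ioo (-1:ℝ) 1) (ht : 0 < t) :
    HasDerivAt (fun y => xt u y t) (p x t) x := by
  refine (S.dx t ht x hx).congr_of_eventuallyEq ?_
  filter_upwards [Ioo_mem_nhds hx.1 hx.2] with y hy
  exact xt_eq (Ioo_subset_Icc_self hy) ht.le
end

open Set Filter Topology MeasureTheory

lemma arctan_sub_ge {y1 y2 N : ℝ} (h : y1 ≤ y2) (h1 : |y1| ≤ N) (h2 : |y2| ≤ N) :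
    (y2 - y1) / (1 + N^2) ≤ Real.arctan y2 - Real.arctan y1 := by
  rcases h.eq_or_lt with rfl | hlt
  · simp
  obtain ⟨c, hc, hc2⟩ := exists_hasDerivAt_eq_slope Real.arctan (fun x => 1 / (1 + x^2)) hlt
    Real.continuous_arctan.continuousOn (fun x _ => Real.hasDerivAt_arctan x)
  have hpos : 0 < y2 - y1 := by linarith
  rw [eq_div_iff hpos.ne'] at hc2
  rw [← hc2, div_mul_eq_mul_div, one_mul]
  have hcN : |c| ≤ N := by
    rw [abs_le] at *; constructor <;> linarith [hc.1, hc.2]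
  have : c^2 ≤ N^2 := sq_le_sq' (by linarith [(abs_le.1 hcN).1]) (abs_le.1 hcN).2
  gcongr

lemma arctan_sub_le {y1 y2 : ℝ} (h : y1 ≤ y2) : Real.arctan y2 - Real.arctan y1 ≤ y2 - y1 := by
  rcases h.eq_or_lt with rfl | hlt
  · simp
  obtain ⟨c, hc, hc2⟩ := exists_hasDerivAt_eq_slope Real.arctan (fun x => 1 / (1 + x^2)) hlt
    Real.continuous_arctan.continuousOn (fun x _ => Real.hasDerivAt_arctan x)
  have hpos : 0 < y2 - y1 := by linarith
  rw [eq_div_iff hpos.ne'] at hc2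
  rw [← hc2]
  have : 1 / (1 + c^2) ≤ 1 := by rw [div_le_one (by positivity)]; nlinarith [sq_nonneg c]
  nlinarith

noncomputable def gs (x : ℝ) : ℝ := Real.sqrt (1 - x^2)
lemma gs_cont : Continuous gs := by unfold gs; fun_prop
lemma gs_nonneg (x : ℝ) : 0 ≤ gs x := Real.sqrt_nonneg _
lemma gs_le_one (x : ℝ) : gs x ≤ 1 := by
  unfold gs; rw [Real.sqrt_le_one]; nlinarith [sq_nonneg x]
lemma gs_sq {x : ℝ} (hx : x ∈ Icc (-1:ℝ) 1) : gs x ^ 2 = 1 - x^2 := by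
  unfold gs; rw [Real.sq_sqrt]; nlinarith [hx.1, hx.2]
lemma gs_pos {x : ℝ} (hx : x ∈ Ioo (-1:ℝ) 1) : 0 < gs x := by
  unfold gs; apply Real.sqrt_pos.2; nlinarith [hx.1, hx.2]
lemma gs_d {x : ℝ} (hx : x ∈ Ioo (-1:ℝ) 1) : HasDerivAt gs (-x / gs x) x := by
  have h0 : (1 - x^2) ≠ 0 := by nlinarith [hx.1, hx.2]
  have h1 : HasDerivAt (fun y : ℝ => 1 - y^2) (-(2*x)) x := by
    simpa using (hasDerivAt_pow 2 x).const_sub 1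
  have := h1.sqrt h0
  refine this.congr_deriv ?_
  have := (gs_pos hx).ne'
  show -(2*x)/(2 * gs x) = _
  field_simp
lemma gs_dd {x : ℝ} (hx : x ∈ Ioo (-1:ℝ) 1) : HasDerivAt (fun y => -y / gs y) (-(1 / gs x ^ 3)) x := by
  have h0 := (gs_pos hx).ne'
  have := (hasDerivAt_id' x).fun_neg.fun_div (gs_d hx) h0
  refine this.congr_deriv ?_
  have h2 := gs_sq (Ioo_subset_Icc_self hx)
  field_simp
  linear_combination -h2

section
variable {x σ : ℝ}

lemma ell_bounds (hx : x ∈ Ioo (-1:ℝ) 1) (hσ : 0 < σ) (hσ1 : σ ≤ 1) :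
    Real.pi * x/2 - σ^2 * (1+x)/2 ∈ Ioo (-(Real.pi/2)) (Real.pi/2) := by
  have hpi := Real.pi_gt_three
  have h2 : σ^2 ≤ 1 := by nlinarith
  have h3 : 0 < σ^2 := by positivity
  have h4 : 0 < 1 + x := by linarith [hx.1]
  have h5 : 0 < 1 - x := by linarith [hx.2]
  constructor
  · nlinarith [mul_pos h4 (show 0 < Real.pi - σ^2 by linarith)]
  · nlinarith [mul_pos h5 Real.pi_pos, mul_pos h4 h3]

/-- `cos ℓ ≥ (2/π) min(A,B)` -/
lemma cos_ell (hx : x ∈ Ioo (-1:ℝ) 1) (hσ : 0 < σ) (hσ1 : σ ≤ 1) :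
    2/Real.pi * (Real.pi * (1-x)/2 + σ^2 * (1+x)/2) ≤ Real.cos (Real.pi * x/2 - σ^2 * (1+x)/2) ∨
    2/Real.pi * ((Real.pi - σ^2) * (1+x)/2) ≤ Real.cos (Real.pi * x/2 - σ^2 * (1+x)/2) := by
  obtain ⟨h1, h2⟩ := ell_bounds hx hσ hσ1
  set ℓ := Real.pi * x/2 - σ^2 * (1+x)/2 with hl
  rcases le_total 0 ℓ with h | h
  · left
    have := Real.mul_le_sin (x := Real.pi/2 - ℓ) (by linarith) (by linarith)
    rw [Real.sin_pi_div_two_sub] at this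
    refine le_trans (le_of_eq ?_) this
    rw [hl]; ring
  · right
    have := Real.mul_le_sin (x := Real.pi/2 + ℓ) (by linarith) (by linarith)
    rw [add_comm (Real.pi/2), Real.sin_add_pi_div_two] at this
    refine le_trans (le_of_eq ?_) this
    rw [hl]; ring

lemma cos_ell_ge (hx : x ∈ Ioo (-1:ℝ) 1) (hσ : 0 < σ) (hσ1 : σ ≤ 1) :
    gs x ^2 / Real.pi ≤ Real.cos (Real.pi * x/2 - σ^2 * (1+x)/2) := by
  have hpi := Real.pi_gt_three
  have h2 : σ^2 ≤ 1 := by nlinarith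
  have h3 : 0 < σ^2 := by positivity
  have h4 : 0 < 1 + x := by linarith [hx.1]
  have h5 : 0 < 1 - x := by linarith [hx.2]
  rw [gs_sq (Ioo_subset_Icc_self hx), div_eq_mul_inv, show (1 - x^2) * Real.pi⁻¹ = 2/Real.pi * ((1-x)*(1+x)/2) by
    field_simp; ring]
  have hp : 0 < 2/Real.pi := by positivity
  rcases cos_ell hx hσ hσ1 with h | h
  · refine le_trans (mul_le_mul_of_nonneg_left ?_ hp.le) h
    nlinarith [mul_pos h4 h3, mul_pos h5 h4]
  · refine le_trans (mul_le_mul_of_nonneg_left ?_ hp.le) h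
    nlinarith [mul_pos h4 h3, mul_pos h5 h4]

lemma psi_le (hx : x ∈ Ioo (-1:ℝ) 1) (hσ : 0 < σ) (hσ1 : σ ≤ 1) :
    σ^2 * (1+x)/2 * gs x ≤ Real.pi/2 * σ * Real.cos (Real.pi * x/2 - σ^2 * (1+x)/2) := by
  have hpi := Real.pi_gt_three
  have h2 : σ^2 ≤ 1 := by nlinarith
  have h3 : 0 < σ^2 := by positivity
  have h4 : 0 < 1 + x := by linarith [hx.1]
  have h5 : 0 < 1 - x := by linarith [hx.2]
  have hg := gs_sq (Ioo_subset_Icc_self hx)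
  have hg1 := gs_le_one x
  have hg0 := gs_pos hx
  have key : ∀ Z, σ^2 * (1+x)/2 * gs x ≤ σ * Z → 2/Real.pi * Z ≤ Real.cos (Real.pi * x/2 - σ^2 * (1+x)/2) →
      σ^2 * (1+x)/2 * gs x ≤ Real.pi/2 * σ * Real.cos (Real.pi * x/2 - σ^2 * (1+x)/2) := by
    intro Z h1 h2
    refine h1.trans ?_
    have : σ * Z = Real.pi/2 * σ * (2/Real.pi * Z) := by field_simp
    rw [this]
    exact mul_le_mul_of_nonneg_left h2 (by positivity)
  rcases cos_ell hx hσ hσ1 with h | h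
  · refine key _ ?_ h
    have hA : 0 ≤ Real.pi * (1-x)/2 + σ^2 * (1+x)/2 := by positivity
    refine (pow_le_pow_iff_left₀ (by positivity) (by positivity) (two_ne_zero)).1 ?_
    rw [mul_pow, hg, mul_pow]
    have e1 : 4 * (Real.pi * (1-x)/2) * (σ^2 * (1+x)/2) ≤ (Real.pi * (1-x)/2 + σ^2 * (1+x)/2)^2 := by
      nlinarith [sq_nonneg (Real.pi * (1-x)/2 - σ^2 * (1+x)/2)]
    have e2 : (σ^2 * (1+x)/2)^2 * (1 - x^2) ≤ σ^2 * (4 * (Real.pi * (1-x)/2) * (σ^2 * (1+x)/2)) := by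
      have e3 : σ^2 * (4 * (Real.pi * (1-x)/2) * (σ^2 * (1+x)/2)) - (σ^2 * (1+x)/2)^2 * (1 - x^2)
        = σ^4 * (1-x) * (1+x) * (Real.pi - (1+x)^2/4) := by ring
      have : 0 ≤ Real.pi - (1+x)^2/4 := by nlinarith [hx.1, hx.2]
      have : 0 ≤ σ^4 * (1-x) * (1+x) * (Real.pi - (1+x)^2/4) := by positivity
      linarith
    exact e2.trans (mul_le_mul_of_nonneg_left e1 h3.le)
  · refine key _ ?_ h
    have e1 : σ^2 * (1+x)/2 * gs x ≤ σ^2 * (1+x)/2 := by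
      have : 0 ≤ σ^2 * (1+x)/2 := by positivity
      nlinarith
    have e2 : σ^2 ≤ σ := by nlinarith
    have e3 : 1 ≤ (Real.pi - σ^2) := by linarith
    calc _ ≤ σ^2 * (1+x)/2 := e1
      _ ≤ σ * (1+x)/2 := by gcongr
      _ ≤ σ * ((Real.pi - σ^2) * (1+x)/2) := by nlinarith [mul_pos hσ h4]

lemma K1 (hx : x ∈ Ioo (-1:ℝ) 1) (hσ : 0 < σ) (hσ1 : σ ≤ 1) :
    Real.tan (Real.pi * x/2) - Real.pi * σ * (1 / gs x ^3) ≤ Real.tan (Real.pi * x/2 - σ^2 * (1+x)/2) := by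
  have hpi := Real.pi_gt_three
  have h4 : 0 < 1 + x := by linarith [hx.1]
  have h5 : 0 < 1 - x := by linarith [hx.2]
  have hg0 := gs_pos hx
  have hg := gs_sq (Ioo_subset_Icc_self hx)
  obtain ⟨h1, h2⟩ := ell_bounds hx hσ hσ1
  have hpsi := psi_le hx hσ hσ1
  set ℓ := Real.pi * x/2 - σ^2 * (1+x)/2 with hl
  have hcl : 0 < Real.cos ℓ := Real.cos_pos_of_mem_Ioo ⟨by linarith, by linarith⟩
  have hcs : gs x ^2 / 2 ≤ Real.cos (Real.pi * x/2) := by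
    rw [hg]
    rcases le_total 0 x with h | h
    · have := Real.mul_le_sin (x := Real.pi/2 - Real.pi * x/2) (by nlinarith) (by nlinarith)
      rw [Real.sin_pi_div_two_sub] at this
      refine le_trans ?_ this
      have : 2/Real.pi * (Real.pi/2 - Real.pi * x/2) = 1 - x := by field_simp
      rw [this]; nlinarith
    · have := Real.mul_le_sin (x := Real.pi * x/2 + Real.pi/2) (by nlinarith) (by nlinarith)
      rw [Real.sin_add_pi_div_two] at this
      refine le_trans ?_ this
      have : 2/Real.pi * (Real.pi * x/2 + Real.pi/2) = 1 + x := by field_simp; ring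
      rw [this]; nlinarith
  have hc : 0 < Real.cos (Real.pi * x/2) := lt_of_lt_of_le (by positivity) hcs
  have e1 : Real.tan (Real.pi * x/2) - Real.tan ℓ = Real.sin (σ^2 * (1+x)/2) / (Real.cos (Real.pi * x/2) * Real.cos ℓ) := by
    have : σ^2 * (1+x)/2 = Real.pi * x/2 - ℓ := by rw [hl]; ring
    rw [this, Real.sin_sub, Real.tan_eq_sin_div_cos, Real.tan_eq_sin_div_cos]
    field_simp
  have e2 : Real.sin (σ^2 * (1+x)/2) ≤ σ^2 * (1+x)/2 := Real.sin_le (by positivity)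
  have e3 : Real.sin (σ^2 * (1+x)/2) / (Real.cos (Real.pi * x/2) * Real.cos ℓ) ≤ Real.pi * σ * (1 / gs x ^3) := by
    rw [div_le_iff₀ (by positivity)]
    refine e2.trans ?_
    have e4 : σ^2 * (1+x)/2 ≤ Real.pi/2 * σ * Real.cos ℓ / gs x := by
      rw [le_div_iff₀ hg0]; exact hpsi
    refine e4.trans ?_
    have e5 : Real.pi/2 * σ * Real.cos ℓ / gs x = Real.pi * σ * (1 / gs x ^3) * ((gs x ^2/2) * Real.cos ℓ) := by
      field_simp
    rw [e5]
    gcongr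
  linarith
end

open Set Filter Topology MeasureTheory

structure Pot (Q Qx p l : ℝ → ℝ → ℝ) : Prop where
  cQ : Continuous (fun z : ℝ × ℝ => Q z.1 z.2)
  dx : ∀ t > (0:ℝ), ∀ x ∈ Ioo (-1:ℝ) 1, HasDerivAt (fun y => Q y t) (Qx x t) x
  dxx : ∀ t > (0:ℝ), ∀ x ∈ Ioo (-1:ℝ) 1, HasDerivAt (fun y => Qx y t) (p x t - Real.tan (Real.pi * x / 2)) x
  dt : ∀ t > (0:ℝ), ∀ x ∈ Ioo (-1:ℝ) 1, HasDerivAt (fun s => Q x s) (Real.arctan (p x t) - l x t) t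
  b1 : ∀ t, Q 1 t = 0
  b2 : ∀ t, Q (-1) t = 0

lemma Pot.upper {Q Qx p l : ℝ → ℝ → ℝ} (P : Pot Q Qx p l)
    (hl : ∀ δ > 0, ∃ T, ∀ t ≥ T, ∀ x ∈ Ioo (-1:ℝ) 1, Real.pi * x / 2 - δ * (1 + x)/2 ≤ l x t) :
    ∀ κ > 0, ∃ T, ∀ t ≥ T, ∀ x ∈ Icc (-1:ℝ) 1, Q x t ≤ κ := by
  intro κ3 hκ3
  have hpi := Real.pi_gt_three
  obtain ⟨κ, hκe⟩ : ∃ κ, κ = κ3/3 := ⟨_, rfl⟩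
  have hκ : 0 < κ := by linarith
  obtain ⟨σ, hσe⟩ : ∃ σ, σ = min 1 (κ/Real.pi) := ⟨_, rfl⟩
  have hσ : 0 < σ := by rw [hσe]; exact lt_min one_pos (by positivity)
  have hσ1 : σ ≤ 1 := by rw [hσe]; exact min_le_left _ _
  have hσκ : Real.pi * σ ≤ κ := by
    have : σ ≤ κ/Real.pi := by rw [hσe]; exact min_le_right _ _
    rw [le_div_iff₀ Real.pi_pos] at this; linarith
  obtain ⟨T0, hT0⟩ := hl (σ^2) (by positivity)
  obtain ⟨t0, ht0e⟩ : ∃ t0, t0 = max T0 1 := ⟨_, rfl⟩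
  have ht0 : 0 < t0 := by rw [ht0e]; positivity
  have hlt : ∀ t ≥ t0, ∀ x ∈ Ioo (-1:ℝ) 1, Real.pi * x / 2 - σ^2 * (1 + x)/2 ≤ l x t := fun t ht x hx =>
    hT0 t (le_trans (by rw [ht0e]; exact le_max_left _ _) ht) x hx
  have hm0 : ∃ m0 > 0, ∀ x ∈ Icc (-1:ℝ) 1, Q x t0 ≤ κ/2 + m0 * gs x := by
    have hcx : Continuous fun x => Q x t0 := P.cQ.comp (f := fun x => (x, t0)) (by fun_prop)
    obtain ⟨B, hB⟩ := isCompact_Icc.exists_bound_of_continuousOn (s := Icc (-1:ℝ) 1) hcx.continuousOn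
    set K := Icc (-1:ℝ) 1 ∩ {x | κ/2 ≤ Q x t0}
    have hK : IsCompact K := isCompact_Icc.inter_right (isClosed_le continuous_const hcx)
    rcases K.eq_empty_or_nonempty with h | h
    · refine ⟨1, one_pos, fun x hx => ?_⟩
      by_contra hh
      push Not at hh
      have : x ∈ K := ⟨hx, show κ/2 ≤ Q x t0 by linarith [gs_nonneg x]⟩
      rw [h] at this; exact this
    · obtain ⟨y, hy, hmin⟩ := hK.exists_isMinOn h gs_cont.continuousOn
      have hyI : y ∈ Ioo (-1:ℝ) 1 := by
        have h2 : κ/2 ≤ Q y t0 := hy.2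
        constructor
        · rcases hy.1.1.eq_or_lt with h1 | h1
          · rw [← h1, P.b2] at h2; linarith
          · exact h1
        · rcases hy.1.2.eq_or_lt with h1 | h1
          · rw [h1, P.b1] at h2; linarith
          · exact h1
      have hgy := gs_pos hyI
      refine ⟨(|B|+1) / gs y, by positivity, fun x hx => ?_⟩
      by_cases hxK : x ∈ K
      · have h1 : gs y ≤ gs x := hmin hxK
        have h2 := (abs_le.1 (hB x hx)).2
        have h3 : (|B|+1) / gs y * gs y ≤ (|B|+1) / gs y * gs x := by gcongr
        rw [div_mul_cancel₀ _ hgy.ne'] at h3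
        linarith [le_abs_self B]
      · have : Q x t0 < κ/2 := by
          by_contra hh; push Not at hh; exact hxK ⟨hx, hh⟩
        have : 0 ≤ (|B|+1) / gs y * gs x := mul_nonneg (by positivity) (gs_nonneg x)
        linarith
  obtain ⟨m0, hm0, hinit⟩ := hm0
  have hgs1 : gs 1 = 0 := by simp [gs]
  have hgs2 : gs (-1) = 0 := by simp [gs]
  -- what we know at a touching point
  have touch : ∀ x ∈ Ioo (-1:ℝ) 1, ∀ t, ∀ m ≥ 0, p x t - Real.tan (Real.pi * x/2) - (Real.pi * σ + m) * (-(1/gs x^3)) ≤ 0 →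
      p x t ≤ Real.tan (Real.pi * x/2 - σ^2 * (1+x)/2) - m := by
    intro x hx t m hm h
    have h1 := K1 hx hσ hσ1
    have hg := gs_pos hx
    have h2 : 1 ≤ 1 / gs x ^3 := by
      rw [le_div_iff₀ (by positivity), one_mul]
      exact pow_le_one₀ hg.le (gs_le_one x)
    nlinarith
  -- phase 1
  have ph1 : ∀ T, ∀ x ∈ Icc (-1:ℝ) 1, ∀ t ∈ Icc t0 T, Q x t - κ/2 - (Real.pi * σ + m0) * gs x ≤ 0 := by
    intro T
    refine par_max (F := fun x t => Q x t - κ/2 - (Real.pi * σ + m0) * gs x)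
      (Fx := fun x t => Qx x t - (Real.pi * σ + m0) * (-x / gs x))
      (Fxx := fun x t => p x t - Real.tan (Real.pi * x/2) - (Real.pi * σ + m0) * (-(1/gs x^3)))
      (Ft := fun x t => Real.arctan (p x t) - l x t) ?_ ?_ ?_ ?_ ?_ ?_ ?_ ?_
    · exact ((P.cQ.sub continuous_const).sub (continuous_const.mul (gs_cont.comp continuous_fst))).continuousOn
    · intro x hx t ht _
      exact ((P.dx t (ht0.trans ht.1) x hx).sub_const _).fun_sub ((gs_d hx).const_mul _)
    · intro x hx t ht _
      exact ((P.dxx t (ht0.trans ht.1) x hx)).fun_sub ((gs_dd hx).const_mul _)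
    · intro x hx t ht _
      exact ((P.dt t (ht0.trans ht.1) x hx).sub_const _).sub_const _
    · intro x hx t ht _ _ h
      have h1 := touch x hx t m0 hm0.le h
      have h2 := hlt t ht.1.le x hx
      obtain ⟨h3, h4⟩ := ell_bounds hx hσ hσ1
      have h5 : Real.arctan (p x t) < Real.arctan (Real.tan (Real.pi * x/2 - σ^2 * (1+x)/2)) :=
        Real.arctan_strictMono (by linarith)
      rw [Real.arctan_tan h3 h4] at h5
      show Real.arctan (p x t) - l x t < 0
      linarith
    · intro x hx
      have := hinit x hx
      have h2 := mul_nonneg (mul_nonneg Real.pi_pos.le hσ.le) (gs_nonneg x)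
      show Q x t0 - κ/2 - (Real.pi * σ + m0) * gs x ≤ 0
      linarith
    · intro t _ h
      simp only [P.b2, hgs2] at h; linarith
    · intro t _ h
      simp only [P.b1, hgs1] at h; linarith
  -- phase 2
  obtain ⟨s0, hs0e⟩ : ∃ s0, s0 = κ / (2 * (Real.pi * σ + m0)) := ⟨_, rfl⟩
  have hpm : 0 < Real.pi * σ + m0 := by positivity
  have hs0 : 0 < s0 := by rw [hs0e]; positivity
  obtain ⟨M, hMe⟩ : ∃ M, M = Real.pi / s0^2 := ⟨_, rfl⟩
  have hM : 0 < M := by rw [hMe]; positivity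
  obtain ⟨γ, hγe⟩ : ∃ γ, γ = 1/(1 + (M + m0)^2)/2 := ⟨_, rfl⟩
  have hγ : 0 < γ := by rw [hγe]; positivity
  set m : ℝ → ℝ := fun t => m0 * Real.exp (-(γ * (t - t0))) with hm
  have hmd : ∀ t, HasDerivAt m (-(γ * m t)) t := by
    intro t
    have := ((((hasDerivAt_id' t).sub_const t0).const_mul γ).fun_neg.exp).const_mul m0
    refine this.congr_deriv ?_
    simp only [hm]; ring
  have hmpos : ∀ t, 0 < m t := fun t => by simp only [hm]; positivity
  have hmle : ∀ t ≥ t0, m t ≤ m0 := fun t ht => by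
    have : Real.exp (-(γ * (t - t0))) ≤ 1 := Real.exp_le_one_iff.2 (by nlinarith)
    simp only [hm]; nlinarith
  have hmc : Continuous m := continuous_iff_continuousAt.2 fun t => (hmd t).continuousAt
  have ph2 : ∀ T, ∀ x ∈ Icc (-1:ℝ) 1, ∀ t ∈ Icc t0 T, Q x t - κ - (Real.pi * σ + m t) * gs x ≤ 0 := by
    intro T
    refine par_max (F := fun x t => Q x t - κ - (Real.pi * σ + m t) * gs x)
      (Fx := fun x t => Qx x t - (Real.pi * σ + m t) * (-x / gs x))
      (Fxx := fun x t => p x t - Real.tan (Real.pi * x/2) - (Real.pi * σ + m t) * (-(1/gs x^3)))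
      (Ft := fun x t => Real.arctan (p x t) - l x t - (-(γ * m t)) * gs x) ?_ ?_ ?_ ?_ ?_ ?_ ?_ ?_
    · exact ((P.cQ.sub continuous_const).sub ((continuous_const.add (hmc.comp continuous_snd)).mul
        (gs_cont.comp continuous_fst))).continuousOn
    · intro x hx t ht _
      exact ((P.dx t (ht0.trans ht.1) x hx).sub_const _).fun_sub ((gs_d hx).const_mul _)
    · intro x hx t ht _
      exact ((P.dxx t (ht0.trans ht.1) x hx)).fun_sub ((gs_dd hx).const_mul _)
    · intro x hx t ht _
      exact ((P.dt t (ht0.trans ht.1) x hx).sub_const _).fun_sub (((hmd t).const_add _).mul_const _)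
    · intro x hx t ht hpos _ h
      have h1 := touch x hx t (m t) (hmpos t).le h
      have h2 := hlt t ht.1.le x hx
      obtain ⟨h3, h4⟩ := ell_bounds hx hσ hσ1
      have hg := gs_pos hx
      have hg1 := gs_le_one x
      have hcos := cos_ell_ge hx hσ hσ1
      have hsx : s0 ≤ gs x := by
        have e1 := ph1 t x (Ioo_subset_Icc_self hx) t ⟨ht.1.le, le_rfl⟩
        have e2 : 0 < (Real.pi * σ + m t) * gs x := by have := hmpos t; positivity
        rw [hs0e, div_le_iff₀ (by positivity)]
        linarith
      set ℓ := Real.pi * x/2 - σ^2 * (1+x)/2 with hℓ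
      have hcl : 0 < Real.cos ℓ := lt_of_lt_of_le (by positivity) hcos
      have htan : |Real.tan ℓ| ≤ M := by
        rw [Real.tan_eq_sin_div_cos, abs_div, abs_of_pos hcl, hMe]
        have e1 : s0^2 / Real.pi ≤ Real.cos ℓ := le_trans (by gcongr) hcos
        have e2 : |Real.sin ℓ| ≤ 1 := Real.abs_sin_le_one ℓ
        rw [div_le_iff₀ hcl]
        calc |Real.sin ℓ| ≤ 1 := e2
          _ = Real.pi / s0^2 * (s0^2 / Real.pi) := by field_simp
          _ ≤ _ := by gcongr
      have hmt := hmle t ht.1.le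
      have hmp := hmpos t
      have h5 := arctan_sub_ge (y1 := Real.tan ℓ - m t) (y2 := Real.tan ℓ) (N := M + m0) (by linarith)
        (by rw [abs_le] at htan ⊢; constructor <;> linarith [htan.1, htan.2]) (by linarith)
      rw [Real.arctan_tan h3 h4] at h5
      have h6 : Real.arctan (p x t) ≤ Real.arctan (Real.tan ℓ - m t) := Real.arctan_strictMono.monotone h1
      have h7 : (Real.tan ℓ - (Real.tan ℓ - m t)) / (1 + (M + m0)^2) = 2 * (γ * m t) := by
        rw [hγe]; field_simp; ring
      rw [h7] at h5
      have h8 : 0 < γ * m t := by positivity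
      show Real.arctan (p x t) - l x t - (-(γ * m t)) * gs x < 0
      nlinarith
    · intro x hx
      have := hinit x hx
      have h2 := mul_nonneg (mul_nonneg Real.pi_pos.le hσ.le) (gs_nonneg x)
      have h3 : m t0 = m0 := by simp [hm]
      show Q x t0 - κ - (Real.pi * σ + m t0) * gs x ≤ 0
      rw [h3]; linarith
    · intro t _ h
      simp only [P.b2, hgs2] at h; linarith
    · intro t _ h
      simp only [P.b1, hgs1] at h; linarith
  have hmt : ∀ᶠ t in atTop, m t < κ := by
    have : Tendsto m atTop (𝓝 (m0 * 0)) := by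
      apply Tendsto.const_mul
      refine Real.tendsto_exp_neg_atTop_nhds_zero.comp ?_
      exact (tendsto_atTop_add_const_right _ (-t0) tendsto_id).const_mul_atTop hγ
    rw [mul_zero] at this
    exact this.eventually (gt_mem_nhds hκ)
  obtain ⟨T1, hT1⟩ := eventually_atTop.1 hmt
  refine ⟨max T1 t0, fun t ht x hx => ?_⟩
  have h1 := ph2 t x hx t ⟨(le_max_right _ _).trans ht, le_rfl⟩
  have h2 := hT1 t ((le_max_left _ _).trans ht)
  have h3 : (Real.pi * σ + m t) * gs x ≤ Real.pi * σ + m t := by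
    have : 0 ≤ Real.pi * σ + m t := by have := hmpos t; positivity
    nlinarith [gs_le_one x]
  linarith

lemma Pot.refl {Q Qx p l : ℝ → ℝ → ℝ} (P : Pot Q Qx p l) :
    Pot (fun x t => - Q (-x) t) (fun x t => Qx (-x) t) (fun x t => - p (-x) t) (fun x t => - l (-x) t) := by
  have hn : ∀ x ∈ Ioo (-1:ℝ) 1, -x ∈ Ioo (-1:ℝ) 1 := fun x hx => ⟨by linarith [hx.2], by linarith [hx.1]⟩
  refine ⟨(P.cQ.comp (f := fun z : ℝ × ℝ => (-z.1, z.2)) (by fun_prop)).neg, ?_, ?_, ?_, ?_, ?_⟩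
  · intro t ht x hx
    have := ((P.dx t ht (-x) (hn x hx)).comp x (hasDerivAt_neg x)).fun_neg
    simpa using this
  · intro t ht x hx
    have := ((P.dxx t ht (-x) (hn x hx)).comp x (hasDerivAt_neg x))
    refine this.congr_deriv ?_
    rw [show Real.pi * -x/2 = -(Real.pi * x/2) by ring, Real.tan_neg]; ring
  · intro t ht x hx
    have := (P.dt t ht (-x) (hn x hx)).fun_neg
    refine this.congr_deriv ?_
    rw [Real.arctan_neg]; ring
  · intro t; simp [P.b2]
  · intro t; simp [P.b1]

lemma Pot.decay {Q Qx p l : ℝ → ℝ → ℝ} (P : Pot Q Qx p l)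
    (hl : ∀ δ > 0, ∃ T, ∀ t ≥ T, ∀ x ∈ Ioo (-1:ℝ) 1, Real.pi * x / 2 - δ * (1 + x)/2 ≤ l x t)
    (hl' : ∀ δ > 0, ∃ T, ∀ t ≥ T, ∀ x ∈ Ioo (-1:ℝ) 1, l x t ≤ Real.pi * x / 2 + δ * (1 - x)/2) :
    ∀ κ > 0, ∃ T, ∀ t ≥ T, ∀ x ∈ Icc (-1:ℝ) 1, |Q x t| ≤ κ := by
  intro κ hκ
  obtain ⟨T1, h1⟩ := P.upper hl κ hκ
  obtain ⟨T2, h2⟩ := P.refl.upper (by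
    intro δ hδ
    obtain ⟨T, hT⟩ := hl' δ hδ
    refine ⟨T, fun t ht x hx => ?_⟩
    have := hT t ht (-x) ⟨by linarith [hx.2], by linarith [hx.1]⟩
    linarith) κ hκ
  refine ⟨max T1 T2, fun t ht x hx => ?_⟩
  have e1 := h1 t ((le_max_left _ _).trans ht) x hx
  have e2 := h2 t ((le_max_right _ _).trans ht) (-x) ⟨by linarith [hx.2], by linarith [hx.1]⟩
  simp only [neg_neg] at e2
  rw [abs_le]; constructor <;> linarith

open Set Filter Topology MeasureTheory

noncomputable def ph (x : ℝ) : ℝ := -(2 / Real.pi) * Real.log (Real.cos (Real.pi * x / 2))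

lemma ph_int (a b : ℝ) : IntervalIntegrable ph volume a b := by
  have h := @intervalIntegrable_log_cos (Real.pi/2 * a) (Real.pi/2 * b)
  have h2 := h.comp_mul_left (c := Real.pi/2) 
  have hp : Real.pi/2 ≠ 0 := by positivity
  rw [mul_div_cancel_left₀ _ hp, mul_div_cancel_left₀ _ hp] at h2
  have h3 := h2.const_mul (-(2/Real.pi))
  refine h3.congr (fun x _ => ?_)
  simp only [ph, Function.comp]
  congr 3; ring

lemma cos_pos_of {x : ℝ} (hx : x ∈ Ioo (-1:ℝ) 1) : 0 < Real.cos (Real.pi * x/2) := by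
  apply Real.cos_pos_of_mem_Ioo
  have := Real.pi_pos
  constructor <;> nlinarith [hx.1, hx.2]

lemma ph_d {x : ℝ} (hx : x ∈ Ioo (-1:ℝ) 1) : HasDerivAt ph (Real.tan (Real.pi * x/2)) x := by
  have hc := cos_pos_of hx
  have h1 : HasDerivAt (fun y : ℝ => Real.pi * y/2) (Real.pi/2) x := by
    simpa using ((hasDerivAt_id' x).const_mul Real.pi).div_const 2
  have := ((h1.cos).log hc.ne').const_mul (-(2/Real.pi))
  refine this.congr_deriv ?_
  rw [Real.tan_eq_sin_div_cos]
  have := Real.pi_pos.ne'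
  field_simp

lemma tan_d {x : ℝ} (hx : x ∈ Ioo (-1:ℝ) 1) :
    HasDerivAt (fun y => Real.tan (Real.pi * y/2)) (Real.pi/2 * (1 + Real.tan (Real.pi * x/2)^2)) x := by
  have hc := cos_pos_of hx
  have h1 : HasDerivAt (fun y : ℝ => Real.pi * y/2) (Real.pi/2) x := by
    simpa using ((hasDerivAt_id' x).const_mul Real.pi).div_const 2
  have := (Real.hasDerivAt_tan hc.ne').comp x h1
  refine this.congr_deriv ?_
  rw [Real.tan_eq_sin_div_cos]
  have := Real.sin_sq_add_cos_sq (Real.pi * x/2)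
  field_simp
  linear_combination -this

noncomputable def c0 : ℝ := (1/2) * ∫ y in (-1:ℝ)..1, ph y
noncomputable def Ga (x : ℝ) : ℝ := (∫ y in (-1:ℝ)..x, ph y) - (1 + x) * c0

lemma Ga_cont : Continuous Ga := by
  have := intervalIntegral.continuous_primitive (μ := volume) (f := ph) ph_int (-1)
  exact this.sub (by fun_prop)

lemma Ga_d {x : ℝ} (hx : x ∈ Ioo (-1:ℝ) 1) : HasDerivAt Ga (ph x - c0) x := by
  have hm : Measurable ph := by unfold ph; fun_prop
  have h1 := intervalIntegral.integral_hasDerivAt_right (f := ph) (ph_int (-1) x)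
    (hm.stronglyMeasurable.stronglyMeasurableAtFilter) (ph_d hx).continuousAt
  have := h1.fun_sub ((((hasDerivAt_id' x).const_add 1)).mul_const c0)
  exact this.congr_deriv (by ring)

section
variable {u p e : ℝ → ℝ → ℝ}

noncomputable def mean (u : ℝ → ℝ → ℝ) (t : ℝ) : ℝ := (1/2) * II u 1 t
noncomputable def QQ (u : ℝ → ℝ → ℝ) (x t : ℝ) : ℝ := II u x t - (1 + x) * mean u t - Ga x
noncomputable def lin (p : ℝ → ℝ → ℝ) (x t : ℝ) : ℝ := th p (-1) t * (1-x)/2 + th p 1 t * (1+x)/2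

lemma Sol.pot (S : Sol u p e) :
    Pot (QQ u) (fun x t => xt u x t - mean u t - (ph x - c0)) p (lin p) := by
  refine ⟨?_, ?_, ?_, ?_, ?_, ?_⟩
  · have h1 : Continuous fun z : ℝ × ℝ => mean u z.2 :=
      continuous_const.mul (S.cII.comp (f := fun z : ℝ × ℝ => (1, z.2)) (by fun_prop))
    exact (S.cII.sub ((continuous_const.add continuous_fst).mul h1)).sub (Ga_cont.comp continuous_fst)
  · intro t ht x hx
    have := ((S.dIIx x t).fun_sub (((hasDerivAt_id' x).const_add 1).mul_const (mean u t))).fun_sub (Ga_d hx)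
    exact this.congr_deriv (by ring)
  · intro t ht x hx
    exact ((S.dUx hx ht).sub_const _).fun_sub ((ph_d hx).sub_const _)
  · intro t ht x hx
    have h1 := S.dIIt (Ioo_subset_Icc_self hx) ht
    have h2 := ((S.dIIt (x := 1) (by norm_num) ht).const_mul (1/2)).const_mul (1+x)
    refine ((h1.fun_sub h2).sub_const (Ga x)).congr_deriv ?_
    simp only [lin, th]; ring
  · intro t; simp only [QQ, mean, Ga, c0, II]; ring
  · intro t; simp [QQ, mean, Ga, II]

lemma Sol.thp (S : Sol u p e) (h0 : ∀ x ∈ Icc (-1:ℝ) 1, 1 ≤ u x 0) {δ : ℝ} (hδ : 0 < δ) :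
    ∃ T, ∀ t ≥ T, Real.pi/2 - δ ≤ th p 1 t ∧ th p (-1) t ≤ -(Real.pi/2) + δ := by
  have h1 : Tendsto (fun t : ℝ => Real.arctan (3/4 + 2/5*t)) atTop (𝓝 (Real.pi/2)) := by
    have h2 : Tendsto (fun t : ℝ => 3/4 + 2/5*t) atTop atTop :=
      tendsto_atTop_add_const_left _ _ (tendsto_id.const_mul_atTop (by norm_num))
    exact (Real.tendsto_arctan_atTop.mono_right nhdsWithin_le_nhds).comp h2
  obtain ⟨T, hT⟩ := eventually_atTop.1 (h1.eventually (lt_mem_nhds (show Real.pi/2 - δ < Real.pi/2 by linarith)))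
  refine ⟨max T 1, fun t ht => ?_⟩
  have ht1 := hT t ((le_max_left _ _).trans ht)
  have ht0 : 0 < t := lt_of_lt_of_le one_pos ((le_max_right _ _).trans ht)
  constructor
  · have := Real.arctan_strictMono.monotone (S.growth h0 1 (by norm_num) t ht0.le)
    rw [th, S.bp t ht0]; linarith
  · have := Real.arctan_strictMono.monotone (S.growth h0 (-1) (by norm_num) t ht0.le)
    rw [th, S.bm t ht0, Real.arctan_neg]; linarith

lemma th_bounds (p : ℝ → ℝ → ℝ) (x t : ℝ) : -(Real.pi/2) < th p x t ∧ th p x t < Real.pi/2 :=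
  ⟨Real.neg_pi_div_two_lt_arctan _, Real.arctan_lt_pi_div_two _⟩

lemma Sol.lin_lower (S : Sol u p e) (h0 : ∀ x ∈ Icc (-1:ℝ) 1, 1 ≤ u x 0) :
    ∀ δ > 0, ∃ T, ∀ t ≥ T, ∀ x ∈ Ioo (-1:ℝ) 1, Real.pi * x / 2 - δ * (1 + x)/2 ≤ lin p x t := by
  intro δ hδ
  obtain ⟨T, hT⟩ := S.thp h0 hδ
  refine ⟨T, fun t ht x hx => ?_⟩
  have h1 := (hT t ht).1
  have h2 := (th_bounds p (-1) t).1
  simp only [lin]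
  nlinarith [hx.1, hx.2]

lemma Sol.lin_upper (S : Sol u p e) (h0 : ∀ x ∈ Icc (-1:ℝ) 1, 1 ≤ u x 0) :
    ∀ δ > 0, ∃ T, ∀ t ≥ T, ∀ x ∈ Ioo (-1:ℝ) 1, lin p x t ≤ Real.pi * x / 2 + δ * (1 - x)/2 := by
  intro δ hδ
  obtain ⟨T, hT⟩ := S.thp h0 hδ
  refine ⟨T, fun t ht x hx => ?_⟩
  have h1 := (hT t ht).2
  have h2 := (th_bounds p 1 t).2
  simp only [lin]
  nlinarith [hx.1, hx.2]

lemma Sol.Q_decay (S : Sol u p e) (h0 : ∀ x ∈ Icc (-1:ℝ) 1, 1 ≤ u x 0) :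
    ∀ κ > 0, ∃ T, ∀ t ≥ T, ∀ x ∈ Icc (-1:ℝ) 1, |QQ u x t| ≤ κ :=
  S.pot.decay (S.lin_lower h0) (S.lin_upper h0)

lemma Sol.mean_d (S : Sol u p e) {t : ℝ} (ht : 0 < t) :
    HasDerivAt (mean u) ((1/2) * (th p 1 t - th p (-1) t)) t :=
  (S.dIIt (x := 1) (by norm_num) ht).const_mul (1/2)
end

open Set Filter Topology MeasureTheory

/-- data for the interior gradient estimate -/
structure Dbl (v q w d : ℝ → ℝ → ℝ) (x0 t0 ρ τ lam C ε : ℝ) : Prop where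
  c : ContinuousOn (fun z : ℝ × ℝ => v z.1 z.2) (Icc (x0-ρ) (x0+ρ) ×ˢ Icc (t0-τ) t0)
  b : ∀ x ∈ Icc (x0-ρ) (x0+ρ), ∀ t ∈ Icc (t0-τ) t0, |v x t| ≤ ε
  dx : ∀ x ∈ Icc (x0-ρ) (x0+ρ), ∀ t ∈ Icc (t0-τ) t0, HasDerivAt (fun y => v y t) (q x t) x
  dxx : ∀ x ∈ Icc (x0-ρ) (x0+ρ), ∀ t ∈ Icc (t0-τ) t0, HasDerivAt (fun y => q y t) (w x t) x
  dt : ∀ x ∈ Icc (x0-ρ) (x0+ρ), ∀ t ∈ Icc (t0-τ) t0, HasDerivAt (fun s => v x s) (d x t) t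
  up : ∀ x ∈ Icc (x0-ρ) (x0+ρ), ∀ t ∈ Icc (t0-τ) t0, |q x t| ≤ 1 → ∀ k, 0 ≤ k → k ≤ 1 →
    w x t ≤ -k → d x t ≤ -lam*k + C*|q x t| + ε
  dn : ∀ x ∈ Icc (x0-ρ) (x0+ρ), ∀ t ∈ Icc (t0-τ) t0, |q x t| ≤ 1 → ∀ k, 0 ≤ k → k ≤ 1 →
    k ≤ w x t → lam*k - C*|q x t| - ε ≤ d x t

lemma Dbl.neg {v q w d : ℝ → ℝ → ℝ} {x0 t0 ρ τ lam C ε : ℝ} (D : Dbl v q w d x0 t0 ρ τ lam C ε) :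
    Dbl (fun x t => -v x t) (fun x t => -q x t) (fun x t => -w x t) (fun x t => -d x t) x0 t0 ρ τ lam C ε where
  c := D.c.neg
  b x hx t ht := by rw [abs_neg]; exact D.b x hx t ht
  dx x hx t ht := (D.dx x hx t ht).fun_neg
  dxx x hx t ht := (D.dxx x hx t ht).fun_neg
  dt x hx t ht := (D.dt x hx t ht).fun_neg
  up x hx t ht hq k h0 h1 hw := by
    rw [abs_neg] at *
    linarith [D.dn x hx t ht hq k h0 h1 (by linarith)]
  dn x hx t ht hq k h0 h1 hw := by
    rw [abs_neg] at *
    linarith [D.up x hx t ht hq k h0 h1 (by linarith)]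

lemma right_deriv_nonpos {f : ℝ → ℝ} {x d : ℝ} (h : ∀ᶠ s in 𝓝[>] x, f s ≤ f x)
    (hd : HasDerivAt f d x) : d ≤ 0 := by
  have h1 : Tendsto (slope f x) (𝓝[>] x) (𝓝 d) :=
    hd.tendsto_slope.mono_left (nhdsWithin_mono _ fun y hy => ne_of_gt hy)
  refine le_of_tendsto h1 ?_
  filter_upwards [h, self_mem_nhdsWithin] with s hs hst
  rw [slope_def_field]
  exact div_nonpos_of_nonpos_of_nonneg (by linarith) (by linarith [show x < s from hst])

set_option maxHeartbeats 1000000 in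
lemma Dbl.one {v q w d : ℝ → ℝ → ℝ} {x0 t0 ρ τ lam C ε : ℝ} (D : Dbl v q w d x0 t0 ρ τ lam C ε)
    {M κ κ' : ℝ} (hρ : 0 < ρ) (hτ : 0 < τ) (hC : 0 ≤ C) (hM0 : 0 ≤ M) (hκ0 : 0 ≤ κ) (hκ'0 : 0 ≤ κ')
    (hM : 2*ε ≤ M) (hκ : 2*ε ≤ κ*ρ^2) (hκ' : 2*ε ≤ κ'*τ)
    (hk0 : 0 ≤ 2*M/ρ^2 - 2*κ) (hk1 : 2*M/ρ^2 - 2*κ ≤ 1) (hq1 : 2*M/ρ + 2*κ*ρ ≤ 1)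
    (hmain : 2*C*(2*M/ρ + 2*κ*ρ) + 2*ε + κ' < 2*lam*(2*M/ρ^2 - 2*κ)) :
    q x0 t0 ≤ 2*M/ρ := by
  set ω : ℝ → ℝ := fun s => 2*s/ρ - s^2/ρ^2 with hω
  have hωd : ∀ s, HasDerivAt ω (2/ρ - 2*s/ρ^2) s := fun s => by
    have := (((hasDerivAt_id' s).const_mul 2).div_const ρ).fun_sub ((hasDerivAt_pow 2 s).div_const (ρ^2))
    exact this.congr_deriv (by norm_num)
  set ω' : ℝ → ℝ := fun s => 2/ρ - 2*s/ρ^2 with hω'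
  have hωdd : ∀ s, HasDerivAt ω' (-(2/ρ^2)) s := fun s => by
    have := (((hasDerivAt_id' s).const_mul 2).div_const (ρ^2)).const_sub (2/ρ)
    exact this.congr_deriv (by norm_num)
  have hωc : Continuous ω := by rw [hω]; fun_prop
  have hω0 : ω 0 = 0 := by simp [hω]
  have hωρ : ω ρ = 1 := by simp only [hω]; field_simp; norm_num
  have hωn : ∀ s, 0 ≤ s → s ≤ ρ → 0 ≤ ω s := by
    intro s h0 h1
    have : ω s = s*(2*ρ - s)/ρ^2 := by simp only [hω]; field_simp
    rw [this]
    exact div_nonneg (mul_nonneg h0 (by linarith)) (by positivity)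
  -- the compact set
  set Kc : Set (ℝ × ℝ × ℝ) := (Icc (x0-ρ) (x0+ρ) ×ˢ Icc (x0-ρ) (x0+ρ) ×ˢ Icc (t0-τ) t0) ∩
    {z | z.2.1 ≤ z.1 ∧ z.1 - z.2.1 ≤ ρ} with hKc
  have hKcc : IsCompact Kc := by
    refine (isCompact_Icc.prod (isCompact_Icc.prod isCompact_Icc)).inter_right ?_
    have g1 : IsClosed {z : ℝ × ℝ × ℝ | z.2.1 ≤ z.1} := isClosed_le (by fun_prop) (by fun_prop)
    have g2 : IsClosed {z : ℝ × ℝ × ℝ | z.1 - z.2.1 ≤ ρ} := isClosed_le (by fun_prop) (by fun_prop)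
    exact g1.inter g2
  set Φ : ℝ × ℝ × ℝ → ℝ := fun z => v z.1 z.2.2 - v z.2.1 z.2.2 - M * ω (z.1 - z.2.1)
    - κ*((z.1-x0)^2 + (z.2.1-x0)^2) - κ'*(t0 - z.2.2) with hΦ
  have hΦc : ContinuousOn Φ Kc := by
    have h1 : ContinuousOn (fun z : ℝ × ℝ × ℝ => v z.1 z.2.2) Kc :=
      D.c.comp (f := fun z : ℝ × ℝ × ℝ => (z.1, z.2.2)) (by fun_prop) (fun z hz => mk_mem_prod hz.1.1 hz.1.2.2)
    have h2 : ContinuousOn (fun z : ℝ × ℝ × ℝ => v z.2.1 z.2.2) Kc :=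
      D.c.comp (f := fun z : ℝ × ℝ × ℝ => (z.2.1, z.2.2)) (by fun_prop) (fun z hz => mk_mem_prod hz.1.2.1 hz.1.2.2)
    have h3 : Continuous fun z : ℝ × ℝ × ℝ => M * ω (z.1 - z.2.1) :=
      continuous_const.mul (hωc.comp (by fun_prop))
    have h4 : Continuous fun z : ℝ × ℝ × ℝ => κ*((z.1-x0)^2 + (z.2.1-x0)^2) := by fun_prop
    have h5 : Continuous fun z : ℝ × ℝ × ℝ => κ'*(t0 - z.2.2) := by fun_prop
    exact (((h1.sub h2).sub h3.continuousOn).sub h4.continuousOn).sub h5.continuousOn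
  have hle : ∀ z ∈ Kc, Φ z ≤ 0 := by
    by_contra hn
    push Not at hn
    obtain ⟨z0, hz0, hz0p⟩ := hn
    obtain ⟨⟨x, y, t⟩, hz, hmax⟩ := hKcc.exists_isMaxOn ⟨z0, hz0⟩ hΦc
    have hp : 0 < Φ (x, y, t) := hz0p.trans_le (hmax hz0)
    obtain ⟨⟨hx, hy, ht⟩, hyx, hxy⟩ := hz
    simp only at hx hy ht hyx hxy
    have hbx := abs_le.1 (D.b x hx t ht)
    have hby := abs_le.1 (D.b y hy t ht)
    have hωs : 0 ≤ M * ω (x - y) := mul_nonneg hM0 (hωn _ (by linarith) hxy)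
    have htt : 0 ≤ κ' * (t0 - t) := mul_nonneg hκ'0 (by linarith [ht.2])
    have hsx : 0 ≤ κ * (x-x0)^2 := by positivity
    have hsy : 0 ≤ κ * (y-x0)^2 := by positivity
    have hp1 : 0 < v x t - v y t - M * ω (x-y) - κ*((x-x0)^2 + (y-x0)^2) - κ'*(t0-t) := hp
    have hp' : 0 < v x t - v y t - M * ω (x-y) - κ*(x-x0)^2 - κ*(y-x0)^2 - κ'*(t0-t) := by linarith
    have h1 : y < x := by
      rcases hyx.eq_or_lt with h | h
      · rw [h, sub_self x, hω0] at hp'; exfalso; linarith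
      · exact h
    have h2 : x - y < ρ := by
      rcases hxy.eq_or_lt with h | h
      · rw [h, hωρ] at hp'; exfalso; linarith
      · exact h
    have h3 : x < x0 + ρ := by
      rcases hx.2.eq_or_lt with h | h
      · have : κ * (x-x0)^2 = κ*ρ^2 := by rw [h]; ring
        exfalso; linarith
      · exact h
    have h4 : x0 - ρ < y := by
      rcases hy.1.eq_or_lt with h | h
      · have : κ * (y-x0)^2 = κ*ρ^2 := by rw [← h]; ring
        exfalso; linarith
      · exact h
    have h5 : t0 - τ < t := by
      rcases ht.1.eq_or_lt with h | h
      · have : κ' * (t0-t) = κ'*τ := by rw [← h]; ring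
        exfalso; linarith
      · exact h
    have hM' : ∀ x' y' t', x' ∈ Icc (x0-ρ) (x0+ρ) → y' ∈ Icc (x0-ρ) (x0+ρ) → t' ∈ Icc (t0-τ) t0 →
        y' ≤ x' → x' - y' ≤ ρ → Φ (x',y',t') ≤ Φ (x,y,t) := fun x' y' t' a b c e f =>
      hmax ⟨⟨a, b, c⟩, e, f⟩
    -- x derivative
    obtain ⟨ex, exx⟩ := sd_max (f := fun x' => Φ (x', y, t))
      (f' := fun x' => q x' t - M * ω' (x' - y) - κ * (2*(x' - x0))) (x := x)
      (d := w x t - M * (-(2/ρ^2)) - κ * 2) (by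
        filter_upwards [Ioo_mem_nhds (show x0-ρ < x by linarith) h3] with x' hx'
        have a1 := D.dx x' (Ioo_subset_Icc_self hx') t ht
        have a2 := ((hωd (x'-y)).comp x' ((hasDerivAt_id' x').sub_const y)).const_mul M
        have a3 := (((((hasDerivAt_id' x').sub_const x0).fun_pow 2).add_const ((y-x0)^2)).const_mul κ)
        refine ((((a1.sub_const (v y t)).fun_sub a2).fun_sub a3).sub_const (κ'*(t0-t))).congr_deriv ?_
        simp only [hω']; norm_num) (by
        have a1 := D.dxx x hx t ht
        have a2 := ((hωdd (x-y)).comp x ((hasDerivAt_id' x).sub_const y)).const_mul M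
        have a3 := ((((hasDerivAt_id' x).sub_const x0).const_mul 2).const_mul κ)
        refine (((a1).fun_sub a2).fun_sub a3).congr_deriv ?_
        norm_num) (by
        filter_upwards [Ioo_mem_nhds (show max (x0-ρ) y < x from max_lt (by linarith) h1)
          (show x < min (x0+ρ) (y+ρ) from lt_min h3 (by linarith))] with x' hx'
        have b1 := max_lt_iff.1 hx'.1
        have b2 := lt_min_iff.1 hx'.2
        exact hM' x' y t ⟨b1.1.le, b2.1.le⟩ hy ht b1.2.le (by linarith [b2.2]))
    obtain ⟨ey, eyy⟩ := sd_max (f := fun y' => Φ (x, y', t))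
      (f' := fun y' => -q y' t + M * ω' (x - y') - κ * (2*(y' - x0))) (x := y)
      (d := -w y t + M * ((2/ρ^2)) - κ * 2) (by
        filter_upwards [Ioo_mem_nhds h4 (show y < x0+ρ by linarith)] with y' hy'
        have a1 := D.dx y' (Ioo_subset_Icc_self hy') t ht
        have a2 := ((hωd (x-y')).comp y' ((hasDerivAt_id' y').const_sub x)).const_mul M
        have a3 := (((((hasDerivAt_id' y').sub_const x0).fun_pow 2).const_add ((x-x0)^2)).const_mul κ)
        refine ((((a1.const_sub (v x t)).fun_sub a2).fun_sub a3).sub_const (κ'*(t0-t))).congr_deriv ?_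
        simp only [hω']; norm_num; ring) (by
        have a1 := (D.dxx y hy t ht).fun_neg
        have a2 := ((hωdd (x-y)).comp y ((hasDerivAt_id' y).const_sub x)).const_mul M
        have a3 := ((((hasDerivAt_id' y).sub_const x0).const_mul 2).const_mul κ)
        refine (((a1).fun_add a2).fun_sub a3).congr_deriv ?_
        norm_num) (by
        filter_upwards [Ioo_mem_nhds (show max (x0-ρ) (x-ρ) < y from max_lt (by linarith) (by linarith))
          (show y < min (x0+ρ) x from lt_min (by linarith) h1)] with y' hy'
        have b1 := max_lt_iff.1 hy'.1
        have b2 := lt_min_iff.1 hy'.2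
        exact hM' x y' t hx ⟨b1.1.le, b2.1.le⟩ ht b2.2.le (by linarith [b1.2]))
    have et : 0 ≤ d x t - d y t + κ' := left_deriv_nonneg (f := fun t' => Φ (x,y,t')) (t := t) (by
        filter_upwards [Ioo_mem_nhdsLT h5] with t' ht'
        exact hM' x y t' hx hy ⟨ht'.1.le, ht'.2.le.trans ht.2⟩ hyx hxy) (by
        have a1 := ((D.dt x hx t ht).fun_sub (D.dt y hy t ht)).sub_const (M * ω (x-y))
        have a2 := ((hasDerivAt_id' t).const_sub t0).const_mul κ'
        refine ((a1.sub_const (κ*((x-x0)^2 + (y-x0)^2))).fun_sub a2).congr_deriv ?_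
        ring)
    have hw0 : 0 ≤ ω' (x-y) := by
      have : ω' (x-y) = 2*(ρ - (x-y))/ρ^2 := by simp only [hω']; field_simp
      rw [this]; exact div_nonneg (by linarith) (by positivity)
    have hw1 : ω' (x-y) ≤ 2/ρ := by
      have : 0 ≤ 2*(x-y)/ρ^2 := div_nonneg (by linarith) (by positivity)
      simp only [hω']; linarith
    have hMw0 := mul_nonneg hM0 hw0
    have hMw1 : M * ω' (x-y) ≤ 2*M/ρ := by
      calc _ ≤ M * (2/ρ) := mul_le_mul_of_nonneg_left hw1 hM0
        _ = _ := by ring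
    have hkx : |κ * (2*(x-x0))| ≤ 2*κ*ρ := by
      rw [abs_le]; constructor <;> nlinarith [hx.1, hx.2]
    have hky : |κ * (2*(y-x0))| ≤ 2*κ*ρ := by
      rw [abs_le]; constructor <;> nlinarith [hy.1, hy.2]
    rw [abs_le] at hkx hky
    have hqx : |q x t| ≤ 2*M/ρ + 2*κ*ρ := by
      rw [abs_le]; constructor <;> linarith [hkx.1, hkx.2]
    have hqy : |q y t| ≤ 2*M/ρ + 2*κ*ρ := by
      rw [abs_le]; constructor <;> linarith [hky.1, hky.2]
    have e0 : M * (2/ρ^2) = 2*M/ρ^2 := by ring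
    have u1 := D.up x hx t ht (hqx.trans hq1) _ hk0 hk1 (by linarith)
    have u2 := D.dn y hy t ht (hqy.trans hq1) _ hk0 hk1 (by linarith)
    have c1 := mul_le_mul_of_nonneg_left hqx hC
    have c2 := mul_le_mul_of_nonneg_left hqy hC
    linarith
  have hfin := right_deriv_nonpos (f := fun x => v x t0 - M * ω (x - x0) - κ * (x-x0)^2) (x := x0)
    (d := q x0 t0 - 2*M/ρ) (by
      filter_upwards [Ioo_mem_nhdsGT (show x0 < x0 + ρ by linarith)] with x hx
      have := hle (x, x0, t0) ⟨⟨⟨by linarith [hx.1], hx.2.le⟩, ⟨by linarith, by linarith⟩,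
        ⟨by linarith, le_rfl⟩⟩, hx.1.le, by simp only; linarith [hx.2]⟩
      simp only [hΦ, sub_self] at this
      simp only [sub_self, hω0]
      linarith) (by
      have a1 := D.dx x0 ⟨by linarith, by linarith⟩ t0 ⟨by linarith, le_rfl⟩
      have a2 := (HasDerivAt.comp (h := fun y => y - x0) x0 (hωd (x0-x0)) ((hasDerivAt_id' x0).sub_const x0)).const_mul M
      have a3 := ((((hasDerivAt_id' x0).sub_const x0).fun_pow 2)).const_mul κ
      refine ((a1.fun_sub a2).fun_sub a3).congr_deriv ?_
      norm_num; ring)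
  linarith

lemma doubling {lam C ρ0 τ : ℝ} (hlam : 0 < lam) (hC : 0 ≤ C) (hρ0 : 0 < ρ0) (hτ : 0 < τ) :
    ∃ ρ > 0, ρ ≤ ρ0 ∧ ∃ K > 0, ∃ ε1 > 0, ∀ ε, 0 < ε → ε ≤ ε1 → ∀ (v q w d : ℝ → ℝ → ℝ) (x0 t0 : ℝ),
      Dbl v q w d x0 t0 ρ τ lam C ε → |q x0 t0| ≤ K * ε := by
  obtain ⟨ρ, hρe⟩ : ∃ ρ, ρ = min ρ0 (lam/(2*(C+1))) := ⟨_, rfl⟩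
  have hρ : 0 < ρ := by rw [hρe]; exact lt_min hρ0 (by positivity)
  have hCρ : C*ρ ≤ lam/2 := by
    have : ρ ≤ lam/(2*(C+1)) := by rw [hρe]; exact min_le_right _ _
    rw [le_div_iff₀ (by positivity)] at this
    nlinarith
  obtain ⟨K1, hK1⟩ : ∃ K1, K1 = 4 + ρ^2/(2*lam)*(8*C/ρ + 3 + 2/τ) := ⟨_, rfl⟩
  have hK1p : 4 ≤ K1 := by
    have : 0 ≤ ρ^2/(2*lam)*(8*C/ρ + 3 + 2/τ) := by positivity
    linarith
  have hK2 : 2*lam*K1/ρ^2 = 8*lam/ρ^2 + (8*C/ρ + 3 + 2/τ) := by rw [hK1]; field_simp; ring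
  obtain ⟨ε1, hε1⟩ : ∃ ε1, ε1 = min (1/(2*K1/ρ^2)) (1/(2*K1/ρ + 4/ρ)) := ⟨_, rfl⟩
  refine ⟨ρ, hρ, by rw [hρe]; exact min_le_left _ _, 2*K1/ρ, by positivity, ε1, by rw [hε1]; positivity, ?_⟩
  intro ε hε hεε v q w d x0 t0 D
  have e1 : ε * (2*K1/ρ^2) ≤ 1 := by
    have := hεε.trans (hε1.trans_le (min_le_left _ _))
    rwa [le_div_iff₀ (by positivity)] at this
  have e2 : ε * (2*K1/ρ + 4/ρ) ≤ 1 := by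
    have := hεε.trans (hε1.trans_le (min_le_right _ _))
    rwa [le_div_iff₀ (by positivity)] at this
  have key : ∀ (v q w d : ℝ → ℝ → ℝ), Dbl v q w d x0 t0 ρ τ lam C ε → q x0 t0 ≤ 2*(K1*ε)/ρ := by
    intro v q w d D
    have hp : 0 < 2*ε/ρ^2 := by positivity
    have hkk : 2*(K1*ε)/ρ^2 - 2*(2*ε/ρ^2) = (2*K1-4) * (ε/ρ^2) := by ring
    refine D.one (M := K1*ε) (κ := 2*ε/ρ^2) (κ' := 2*ε/τ) hρ hτ hC (by positivity) (by positivity)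
      (by positivity) (by nlinarith) (by field_simp; exact le_rfl) (by field_simp; exact le_rfl) ?_ ?_ ?_ ?_
    · rw [hkk]; exact mul_nonneg (by linarith) (by positivity)
    · have : 2*(K1*ε)/ρ^2 = ε * (2*K1/ρ^2) := by ring
      linarith
    · have : 2*(K1*ε)/ρ + 2*(2*ε/ρ^2)*ρ = ε * (2*K1/ρ + 4/ρ) := by field_simp; ring
      linarith
    · have f1 : 2*C*(2*(K1*ε)/ρ + 2*(2*ε/ρ^2)*ρ) = ε * ((C*ρ) * (4*K1/ρ^2) + 8*C/ρ) := by field_simp; ring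
      have f2 : 2*lam*(2*(K1*ε)/ρ^2 - 2*(2*ε/ρ^2)) = ε * (2*(2*lam*K1/ρ^2) - 8*lam/ρ^2) := by ring
      have f3 : (C*ρ) * (4*K1/ρ^2) ≤ lam/2 * (4*K1/ρ^2) := mul_le_mul_of_nonneg_right hCρ (by positivity)
      have f4 : lam/2 * (4*K1/ρ^2) = 2*lam*K1/ρ^2 := by ring
      have f5 : 2*ε/τ = ε*(2/τ) := by ring
      rw [f1, f2, f5]
      nlinarith
  have h1 := key v q w d D
  have h2 := key _ _ _ _ D.neg
  have h3 : 2*K1/ρ*ε = 2*(K1*ε)/ρ := by ring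
  rw [h3, abs_le]; constructor <;> linarith

open Set Filter Topology MeasureTheory

lemma box_mem {r ρ x0 x : ℝ} (hr1 : r < 1) (hρ : ρ ≤ (1-r)/2) (hx0 : x0 ∈ Icc (-r) r)
    (hx : x ∈ Icc (x0-ρ) (x0+ρ)) : x ∈ Icc (-((1+r)/2)) ((1+r)/2) ∧ x ∈ Ioo (-1:ℝ) 1 := by
  refine ⟨⟨?_, ?_⟩, ?_, ?_⟩ <;> linarith [hx0.1, hx0.2, hx.1, hx.2]

lemma tan_bd {R : ℝ} (hR1 : R < 1) : ∃ M > 0, ∀ x ∈ Icc (-R) R, |Real.tan (Real.pi * x/2)| ≤ M := by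
  have hc : ContinuousOn (fun x => Real.tan (Real.pi * x/2)) (Icc (-R) R) := fun x hx =>
    (tan_d (x := x) ⟨by linarith [hx.1], by linarith [hx.2]⟩).continuousAt.continuousWithinAt
  obtain ⟨B, hB⟩ := isCompact_Icc.exists_bound_of_continuousOn hc
  refine ⟨max B 1, by positivity, fun x hx => ?_⟩
  have := hB x hx
  rw [Real.norm_eq_abs] at this
  exact this.trans (le_max_left _ _)

lemma arctan_tan' {x : ℝ} (hx : x ∈ Ioo (-1:ℝ) 1) : Real.arctan (Real.tan (Real.pi * x/2)) = Real.pi * x/2 := by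
  have := Real.pi_pos
  apply Real.arctan_tan <;> nlinarith [hx.1, hx.2]

section
variable {u p e : ℝ → ℝ → ℝ}

lemma Sol.dTt (S : Sol u p e) {x t : ℝ} (hx : x ∈ Ioo (-1:ℝ) 1) (ht : 0 < t) :
    HasDerivAt (fun s => xt u x s) (e x t / (1 + p x t ^ 2)) t := by
  refine (S.dt t ht x hx).congr_of_eventuallyEq ?_
  filter_upwards [lt_mem_nhds ht] with s hs using xt_eq (Ioo_subset_Icc_self hx) hs.le

lemma Sol.conv_a (S : Sol u p e) (h0 : ∀ x ∈ Icc (-1:ℝ) 1, 1 ≤ u x 0) {r : ℝ} (hr0 : 0 ≤ r) (hr1 : r < 1)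
    {η : ℝ} (hη : 0 < η) : ∃ T, ∀ t ≥ T, ∀ x ∈ Icc (-r) r,
      |xt u x t - mean u t - (ph x - c0)| ≤ η := by
  obtain ⟨M, hM, hMb⟩ := tan_bd (R := (1+r)/2) (by linarith)
  obtain ⟨lam, hlame⟩ : ∃ lam, lam = 1/(1+(M+1)^2) := ⟨_, rfl⟩
  obtain ⟨ρ, hρ, hρ0, K, hK, ε1, hε1, hD⟩ := doubling (lam := lam) (C := 0) (ρ0 := (1-r)/2) (τ := 1)
    (by rw [hlame]; positivity) le_rfl (by linarith) one_pos
  obtain ⟨ε, hεe⟩ : ∃ ε, ε = min ε1 (η/K) := ⟨_, rfl⟩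
  have hε : 0 < ε := by rw [hεe]; exact lt_min hε1 (by positivity)
  have hεK : K*ε ≤ η := by
    have : ε ≤ η/K := by rw [hεe]; exact min_le_right _ _
    rw [le_div_iff₀ hK] at this; linarith
  obtain ⟨T1, hT1⟩ := S.Q_decay h0 ε hε
  obtain ⟨T2, hT2⟩ := S.lin_lower h0 ε hε
  obtain ⟨T3, hT3⟩ := S.lin_upper h0 ε hε
  have P := S.pot
  refine ⟨max (max T1 T2) (max T3 1) + 1, fun t0 ht0 x0 hx0 => ?_⟩
  refine le_trans ?_ hεK
  have htt : ∀ t ∈ Icc (t0-1) t0, T1 ≤ t ∧ T2 ≤ t ∧ T3 ≤ t ∧ 0 < t := by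
    intro t ht
    have h1 : max (max T1 T2) (max T3 1) ≤ t := by linarith [ht.1]
    simp only [max_le_iff] at h1
    exact ⟨h1.1.1, h1.1.2, h1.2.1, by linarith [h1.2.2]⟩
  refine hD ε hε (by rw [hεe]; exact min_le_left _ _) (QQ u) (fun x t => xt u x t - mean u t - (ph x - c0))
    (fun x t => p x t - Real.tan (Real.pi * x/2)) (fun x t => Real.arctan (p x t) - lin p x t) x0 t0 ?_
  refine ⟨P.cQ.continuousOn, ?_, ?_, ?_, ?_, ?_, ?_⟩
  · intro x hx t ht
    exact hT1 t (htt t ht).1 x (Ioo_subset_Icc_self (box_mem hr1 hρ0 hx0 hx).2)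
  · intro x hx t ht
    exact P.dx t (htt t ht).2.2.2 x (box_mem hr1 hρ0 hx0 hx).2
  · intro x hx t ht
    exact P.dxx t (htt t ht).2.2.2 x (box_mem hr1 hρ0 hx0 hx).2
  · intro x hx t ht
    exact P.dt t (htt t ht).2.2.2 x (box_mem hr1 hρ0 hx0 hx).2
  · intro x hx t ht hq k hk0 hk1 hw
    obtain ⟨hb1, hb2⟩ := box_mem hr1 hρ0 hx0 hx
    have hl := hT2 t (htt t ht).2.1 x hb2
    have hM1 := abs_le.1 (hMb x hb1)
    have a1 : Real.arctan (p x t) ≤ Real.arctan (Real.tan (Real.pi * x/2) - k) :=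
      Real.arctan_strictMono.monotone (by linarith)
    have a2 := arctan_sub_ge (N := M+1) (show Real.tan (Real.pi * x/2) - k ≤ Real.tan (Real.pi * x/2) by linarith)
      (by rw [abs_le]; constructor <;> linarith) (by rw [abs_le]; constructor <;> linarith)
    rw [arctan_tan' hb2, show (Real.tan (Real.pi * x/2) - (Real.tan (Real.pi * x/2) - k))/(1+(M+1)^2) = lam * k by
      rw [hlame]; ring] at a2
    nlinarith [hb2.1, hb2.2]
  · intro x hx t ht hq k hk0 hk1 hw
    obtain ⟨hb1, hb2⟩ := box_mem hr1 hρ0 hx0 hx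
    have hl := hT3 t (htt t ht).2.2.1 x hb2
    have hM1 := abs_le.1 (hMb x hb1)
    have a1 : Real.arctan (Real.tan (Real.pi * x/2) + k) ≤ Real.arctan (p x t) :=
      Real.arctan_strictMono.monotone (by linarith)
    have a2 := arctan_sub_ge (N := M+1) (show Real.tan (Real.pi * x/2) ≤ Real.tan (Real.pi * x/2) + k by linarith)
      (by rw [abs_le]; constructor <;> linarith) (by rw [abs_le]; constructor <;> linarith)
    rw [arctan_tan' hb2, show (Real.tan (Real.pi * x/2) + k - (Real.tan (Real.pi * x/2)))/(1+(M+1)^2) = lam * k by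
      rw [hlame]; ring] at a2
    nlinarith [hb2.1, hb2.2]

/-- algebra for the second application -/
lemma alg_b {P q e' M lam k : ℝ} (hP : |P| ≤ M) (hq : |q| ≤ 1) (hlam : lam = 1/(1+(M+1)^2)) (hk : 0 ≤ k) :
    (e' - Real.pi/2*(1+P^2) ≤ -k → e'/(1+(P+q)^2) ≤ Real.pi/2 - lam*k + Real.pi/2*(2*M+1)*|q|) ∧
    (k ≤ e' - Real.pi/2*(1+P^2) → Real.pi/2 + lam*k - Real.pi/2*(2*M+1)*|q| ≤ e'/(1+(P+q)^2)) := by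
  have hpi := Real.pi_pos
  have hD : 0 < 1+(P+q)^2 := by positivity
  have hD1 : 1 ≤ 1+(P+q)^2 := by nlinarith [sq_nonneg (P+q)]
  have hP' := abs_le.1 hP
  have hq' := abs_le.1 hq
  have hD2 : 1+(P+q)^2 ≤ 1+(M+1)^2 := by
    have : (P+q)^2 ≤ (M+1)^2 := sq_le_sq' (by linarith) (by linarith)
    linarith
  have hlk : lam*k*(1+(P+q)^2) ≤ k := by
    have : lam*(1+(P+q)^2) ≤ 1 := by
      rw [hlam, one_div_mul_eq_div, div_le_one (by positivity)]; exact hD2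
    nlinarith
  have hM0 : 0 ≤ M := (abs_nonneg P).trans hP
  have hqq : |q*(2*P+q)| ≤ (2*M+1)*|q| * (1+(P+q)^2) := by
    rw [abs_mul]
    have h1 : |2*P+q| ≤ 2*M+1 := by rw [abs_le]; constructor <;> linarith
    have h2 : |q| * |2*P+q| ≤ |q| * (2*M+1) := mul_le_mul_of_nonneg_left h1 (abs_nonneg q)
    have h3 : 0 ≤ (2*M+1)*|q| := by positivity
    nlinarith
  obtain ⟨h5, h6⟩ := abs_le.1 hqq
  have h5' := mul_le_mul_of_nonneg_left h5 (show 0 ≤ Real.pi/2 by positivity)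
  have h6' := mul_le_mul_of_nonneg_left h6 (show 0 ≤ Real.pi/2 by positivity)
  constructor
  · intro h
    rw [div_le_iff₀ hD]
    linarith
  · intro h
    rw [le_div_iff₀ hD]
    linarith

lemma Sol.conv_b (S : Sol u p e) (h0 : ∀ x ∈ Icc (-1:ℝ) 1, 1 ≤ u x 0) {r : ℝ} (hr0 : 0 ≤ r) (hr1 : r < 1)
    {η : ℝ} (hη : 0 < η) : ∃ T, ∀ t ≥ T, ∀ x ∈ Icc (-r) r,
      |p x t - Real.tan (Real.pi * x/2)| ≤ η := by
  have hpi := Real.pi_pos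
  obtain ⟨M, hM, hMb⟩ := tan_bd (R := (1+r)/2) (by linarith)
  obtain ⟨lam, hlame⟩ : ∃ lam, lam = 1/(1+(M+1)^2) := ⟨_, rfl⟩
  obtain ⟨ρ, hρ, hρ0, K, hK, ε1, hε1, hD⟩ := doubling (lam := lam) (C := Real.pi/2*(2*M+1)) (ρ0 := (1-r)/2) (τ := 1)
    (by rw [hlame]; positivity) (by positivity) (by linarith) one_pos
  obtain ⟨ε, hεe⟩ : ∃ ε, ε = min ε1 (η/K) := ⟨_, rfl⟩
  have hε : 0 < ε := by rw [hεe]; exact lt_min hε1 (by positivity)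
  have hεK : K*ε ≤ η := by
    have : ε ≤ η/K := by rw [hεe]; exact min_le_right _ _
    rw [le_div_iff₀ hK] at this; linarith
  obtain ⟨T1, hT1⟩ := S.conv_a h0 (r := (1+r)/2) (by linarith) (by linarith) hε
  obtain ⟨T2, hT2⟩ := S.thp h0 hε
  have P := S.pot
  refine ⟨max T1 (max T2 1) + 1, fun t0 ht0 x0 hx0 => ?_⟩
  refine le_trans ?_ hεK
  have htt : ∀ t ∈ Icc (t0-1) t0, T1 ≤ t ∧ T2 ≤ t ∧ 0 < t := by
    intro t ht
    have h1 : max T1 (max T2 1) ≤ t := by linarith [ht.1]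
    simp only [max_le_iff] at h1
    exact ⟨h1.1, h1.2.1, by linarith [h1.2.2]⟩
  refine hD ε hε (by rw [hεe]; exact min_le_left _ _) (fun x t => xt u x t - mean u t - (ph x - c0))
    (fun x t => p x t - Real.tan (Real.pi * x/2)) (fun x t => e x t - Real.pi/2 * (1 + Real.tan (Real.pi * x/2)^2))
    (fun x t => e x t / (1 + p x t^2) - (1/2) * (th p 1 t - th p (-1) t)) x0 t0 ?_
  have hmd : ∀ t ∈ Icc (t0-1) t0, (1/2) * (th p 1 t - th p (-1) t) ≤ Real.pi/2 ∧
      Real.pi/2 - ε ≤ (1/2) * (th p 1 t - th p (-1) t) := by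
    intro t ht
    have := hT2 t (htt t ht).2.1
    have := th_bounds p 1 t
    have := th_bounds p (-1) t
    constructor <;> linarith
  refine ⟨?_, ?_, ?_, ?_, ?_, ?_, ?_⟩
  · have h1 : Continuous fun z : ℝ × ℝ => mean u z.2 :=
      continuous_const.mul (S.cII.comp (f := fun z : ℝ × ℝ => (1, z.2)) (by fun_prop))
    have h2 : ContinuousOn (fun x => ph x - c0) (Icc (x0-ρ) (x0+ρ)) := fun x hx =>
      ((ph_d (box_mem hr1 hρ0 hx0 hx).2).continuousAt.continuousWithinAt).sub continuousWithinAt_const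
    exact (S.cU.sub h1).continuousOn.sub
      (h2.comp (f := fun z : ℝ × ℝ => z.1) continuousOn_fst (fun z hz => hz.1))
  · intro x hx t ht
    exact hT1 t (htt t ht).1 x (box_mem hr1 hρ0 hx0 hx).1
  · intro x hx t ht
    exact P.dxx t (htt t ht).2.2 x (box_mem hr1 hρ0 hx0 hx).2
  · intro x hx t ht
    have hb := (box_mem hr1 hρ0 hx0 hx).2
    exact (S.dxx t (htt t ht).2.2 x hb).fun_sub (tan_d hb)
  · intro x hx t ht
    have hb := (box_mem hr1 hρ0 hx0 hx).2
    exact ((S.dTt hb (htt t ht).2.2).fun_sub (S.mean_d (htt t ht).2.2)).sub_const _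
  · intro x hx t ht hq k hk0 hk1 hw
    have hb := (box_mem hr1 hρ0 hx0 hx).1
    have := (alg_b (e' := e x t) (hMb x hb) hq hlame hk0).1 hw
    rw [add_sub_cancel] at this
    linarith [(hmd t ht).2]
  · intro x hx t ht hq k hk0 hk1 hw
    have hb := (box_mem hr1 hρ0 hx0 hx).1
    have := (alg_b (e' := e x t) (hMb x hb) hq hlame hk0).2 hw
    rw [add_sub_cancel] at this
    linarith [(hmd t ht).1]

lemma Sol.conv_c0 (S : Sol u p e) (h0 : ∀ x ∈ Icc (-1:ℝ) 1, 1 ≤ u x 0) {r : ℝ} (hr0 : 0 ≤ r) (hr1 : r < 1)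
    {η : ℝ} (hη : 0 < η) : ∃ T > 0, ∀ t ≥ T, ∀ x ∈ Icc (-r) r, ∀ h, 0 < h →
      |(xt u x (t+h) - xt u x t)/h - Real.pi/2| ≤ η := by
  have hpi := Real.pi_pos
  obtain ⟨M, hM, hMb⟩ := tan_bd (R := (1+r)/2) (by linarith)
  obtain ⟨lam, hlame⟩ : ∃ lam, lam = 1/(1+(M+1)^2) := ⟨_, rfl⟩
  obtain ⟨ρ, hρ, hρ0, K, hK, ε1, hε1, hD⟩ := doubling (lam := lam) (C := 0) (ρ0 := (1-r)/2) (τ := 1)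
    (by rw [hlame]; positivity) le_rfl (by linarith) one_pos
  obtain ⟨ε, hεe⟩ : ∃ ε, ε = min ε1 (η/K) := ⟨_, rfl⟩
  have hε : 0 < ε := by rw [hεe]; exact lt_min hε1 (by positivity)
  have hεK : K*ε ≤ η := by
    have : ε ≤ η/K := by rw [hεe]; exact min_le_right _ _
    rw [le_div_iff₀ hK] at this; linarith
  obtain ⟨T1, hT1⟩ := S.conv_b h0 (r := (1+r)/2) (by linarith) (by linarith) (lt_min hε one_pos)
  refine ⟨max T1 1 + 1, by positivity, fun t0 ht0 x0 hx0 h hh => ?_⟩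
  refine le_trans ?_ hεK
  have htt : ∀ t, t0 - 1 ≤ t → T1 ≤ t ∧ 0 < t := by
    intro t ht
    have h1 : max T1 1 ≤ t := by linarith
    simp only [max_le_iff] at h1
    exact ⟨h1.1, by linarith [h1.2]⟩
  have hpM : ∀ t, t0 - 1 ≤ t → ∀ x ∈ Icc (x0-ρ) (x0+ρ), |p x t| ≤ M+1 := by
    intro t ht x hx
    have hb := (box_mem hr1 hρ0 hx0 hx).1
    have a1 := abs_le.1 ((hT1 t (htt t ht).1 x hb).trans (min_le_right _ _))
    have a2 := abs_le.1 (hMb x hb)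
    rw [abs_le]; constructor <;> linarith
  have hth : ∀ t, t0 - 1 ≤ t → ∀ x ∈ Icc (x0-ρ) (x0+ρ), |xt (th p) x t - Real.pi*x/2| ≤ ε := by
    intro t ht x hx
    obtain ⟨hb, hb2⟩ := (box_mem hr1 hρ0 hx0 hx)
    have a1 := abs_le.1 ((hT1 t (htt t ht).1 x hb).trans (min_le_left _ _))
    rw [xt_eq (Ioo_subset_Icc_self hb2) (htt t ht).2.le, th, ← arctan_tan' hb2, arctan_tan' hb2]
    have a3 := arctan_tan' hb2
    rcases le_total (p x t) (Real.tan (Real.pi * x/2)) with hc | hc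
    · have := arctan_sub_le hc
      have h5 := Real.arctan_strictMono.monotone hc
      rw [abs_le]; constructor <;> linarith
    · have := arctan_sub_le hc
      have h5 := Real.arctan_strictMono.monotone hc
      rw [abs_le]; constructor <;> linarith
  obtain ⟨Fb, hFb⟩ : ∃ Fb : ℝ → ℝ, Fb = fun t => ∫ s in (0:ℝ)..t, xt (th p) (-1) s := ⟨_, rfl⟩
  have hFd : ∀ t, HasDerivAt Fb (xt (th p) (-1) t) t := fun t => by
    rw [hFb]; exact (S.cTt (-1)).integral_hasStrictDerivAt 0 t |>.hasDerivAt
  have hFc : Continuous Fb := continuous_iff_continuousAt.2 fun t => (hFd t).continuousAt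
  have hval : ∀ x ∈ Icc (-1:ℝ) 1, ∀ t, 0 < t →
      II u x (t+h) - II u x t + (Fb (t+h) - Fb t) = ∫ s in t..(t+h), xt (th p) x s := by
    intro x hx t ht
    have g := S.green hx ht (show t ≤ t+h by linarith)
    rw [intervalIntegral.integral_sub ((S.cTt x).intervalIntegrable (μ := volume) _ _) ((S.cTt (-1)).intervalIntegrable (μ := volume) _ _)] at g
    have g2 := intervalIntegral.integral_interval_sub_left ((S.cTt (-1)).intervalIntegrable (μ := volume) 0 (t+h))
      ((S.cTt (-1)).intervalIntegrable (μ := volume) 0 t)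
    rw [g, hFb]; simp only; rw [g2]; ring
  refine hD ε hε (by rw [hεe]; exact min_le_left _ _)
    (fun x t => (II u x (t+h) - II u x t + (Fb (t+h) - Fb t))/h - Real.pi*x/2)
    (fun x t => (xt u x (t+h) - xt u x t)/h - Real.pi/2)
    (fun x t => (p x (t+h) - p x t)/h)
    (fun x t => (th p x (t+h) - th p x t)/h) x0 t0 ?_
  refine ⟨?_, ?_, ?_, ?_, ?_, ?_, ?_⟩
  · refine Continuous.continuousOn ?_
    have h1 : Continuous fun z : ℝ × ℝ => II u z.1 (z.2+h) := S.cII.comp (f := fun z : ℝ × ℝ => (z.1, z.2+h)) (by fun_prop)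
    have h2 := S.cII
    fun_prop
  · intro x hx t ht
    obtain ⟨hb, hb2⟩ := (box_mem hr1 hρ0 hx0 hx)
    have ht0' : 0 < t := (htt t ht.1).2
    rw [hval x (Ioo_subset_Icc_self hb2) t ht0']
    have hInterior := (S.cTt x).intervalIntegrable (μ := volume) t (t+h)
    have e1 : (∫ s in t..(t+h), xt (th p) x s) / h - Real.pi * x/2 =
        (∫ s in t..(t+h), (xt (th p) x s - Real.pi*x/2))/h := by
      rw [intervalIntegral.integral_sub hInterior (by simp), intervalIntegral.integral_const]
      simp only [add_sub_cancel_left, smul_eq_mul]; field_simp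
    rw [e1, abs_div, abs_of_pos hh, div_le_iff₀ hh]
    have := intervalIntegral.norm_integral_le_of_norm_le_const (a := t) (b := t+h) (C := ε)
      (f := fun s => xt (th p) x s - Real.pi*x/2) (fun s hs => by
        rw [uIoc_of_le (by linarith)] at hs
        exact hth s (by linarith [hs.1, ht.1]) x hx)
    rw [add_sub_cancel_left, abs_of_pos hh] at this
    exact this
  · intro x hx t ht
    have a1 := ((((S.dIIx x (t+h)).fun_sub (S.dIIx x t)).add_const (Fb (t+h) - Fb t)).div_const h).fun_sub
      (((hasDerivAt_id' x).const_mul Real.pi).div_const 2)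
    exact a1.congr_deriv (by ring)
  · intro x hx t ht
    have hb := (box_mem hr1 hρ0 hx0 hx).2
    have ht0' : 0 < t := (htt t ht.1).2
    exact (((S.dUx hb (show 0 < t+h by linarith)).fun_sub (S.dUx hb ht0')).div_const h).sub_const _
  · intro x hx t ht
    have hb := Ioo_subset_Icc_self (box_mem hr1 hρ0 hx0 hx).2
    have ht0' : 0 < t := (htt t ht.1).2
    have b1 := (S.dIIt hb (show 0 < t+h by linarith)).comp_add_const t h
    have b2 := S.dIIt hb ht0'
    have b3 := (hFd (t+h)).comp_add_const t h
    have b4 := hFd t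
    refine ((((b1.fun_sub b2).fun_add (b3.fun_sub b4)).div_const h).sub_const _).congr_deriv ?_
    rw [xt_eq (by norm_num) ht0'.le, xt_eq (by norm_num) (by linarith)]
    ring
  · intro x hx t ht hq k hk0 hk1 hw
    rw [div_le_iff₀ hh] at hw
    have hle : p x (t+h) ≤ p x t := by nlinarith
    have := arctan_sub_ge hle (hpM (t+h) (by linarith [ht.1]) x hx) (hpM t ht.1 x hx)
    rw [div_eq_mul_one_div, ← hlame] at this
    rw [zero_mul, add_zero]
    have h2 : th p x (t+h) - th p x t ≤ -lam*k*h := by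
      have hl : 0 ≤ lam := by rw [hlame]; positivity
      simp only [th]; nlinarith
    have h3 : (th p x (t+h) - th p x t)/h ≤ -lam*k := by rw [div_le_iff₀ hh]; exact h2
    linarith
  · intro x hx t ht hq k hk0 hk1 hw
    rw [le_div_iff₀ hh] at hw
    have hle : p x t ≤ p x (t+h) := by nlinarith
    have := arctan_sub_ge hle (hpM t ht.1 x hx) (hpM (t+h) (by linarith [ht.1]) x hx)
    rw [div_eq_mul_one_div, ← hlame] at this
    rw [zero_mul]
    have h2 : lam*k*h ≤ th p x (t+h) - th p x t := by
      have hl : 0 ≤ lam := by rw [hlame]; positivity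
      simp only [th]; nlinarith
    have h3 : lam*k ≤ (th p x (t+h) - th p x t)/h := by rw [le_div_iff₀ hh]; exact h2
    linarith

lemma Sol.conv_c (S : Sol u p e) (h0 : ∀ x ∈ Icc (-1:ℝ) 1, 1 ≤ u x 0) {r : ℝ} (hr0 : 0 ≤ r) (hr1 : r < 1)
    {η : ℝ} (hη : 0 < η) : ∃ T > 0, ∀ t ≥ T, ∀ x ∈ Icc (-r) r,
      |e x t / (1 + p x t^2) - Real.pi/2| ≤ η := by
  obtain ⟨T, hT0, hT⟩ := S.conv_c0 h0 hr0 hr1 hη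
  refine ⟨T, hT0, fun t ht x hx => ?_⟩
  have hd := S.dTt (x := x) (t := t) ⟨by linarith [hx.1], by linarith [hx.2]⟩ (by linarith)
  have h1 : Tendsto (slope (fun s => xt u x s) t) (𝓝[>] t) (𝓝 (e x t / (1 + p x t^2))) :=
    hd.tendsto_slope.mono_left (nhdsWithin_mono _ fun y hy => ne_of_gt hy)
  refine le_of_tendsto ((h1.sub_const (Real.pi/2)).abs) ?_
  filter_upwards [self_mem_nhdsWithin] with s hs
  have hs' : t < s := hs
  have := hT t ht x hx (s-t) (by linarith)
  rw [add_sub_cancel] at this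
  rw [slope_def_field]; exact this
end

open Real Set Filter Topology MeasureTheory

lemma compact_box {K : Set (ℝ × ℝ)} (hK : IsCompact K) (hs : K ⊆ Set.Ioo (-1 : ℝ) 1 ×ˢ (Set.univ : Set ℝ)) :
    ∃ r, 0 ≤ r ∧ r < 1 ∧ ∃ L, 0 ≤ L ∧ ∀ z ∈ K, z.1 ∈ Icc (-r) r ∧ |z.2| ≤ L := by
  rcases K.eq_empty_or_nonempty with h | h
  · exact ⟨0, le_rfl, one_pos, 0, le_rfl, by simp [h]⟩
  obtain ⟨a, ha, ha'⟩ := hK.exists_isMaxOn h (f := fun z => |z.1|) (by fun_prop)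
  obtain ⟨b, hb, hb'⟩ := hK.exists_isMaxOn h (f := fun z => |z.2|) (by fun_prop)
  refine ⟨|a.1|, abs_nonneg _, abs_lt.2 (hs ha).1, |b.2|, abs_nonneg _, fun z hz => ⟨?_, hb' hz⟩⟩
  exact abs_le.1 (ha' hz)

lemma ph_zero : ph 0 = 0 := by simp [ph]

/-- the main convergence theorem. If `u` is a time-global
classical solution of (B) with `u0 ≥ 1` and `u0'(±1) = ±u0(±1)`, then
`u(x,t) → ∞` as `t → ∞` uniformly in `x`, and `u(x,t+s) − u(0,s)` converges
as `s → ∞` to `φ0(x) + (π/2)t` uniformly, together with its first and second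
`x`-derivatives and first `t`-derivative, on every compact subset of
`(-1,1) × ℝ`, where `φ0(x) = -(2/π)·ln(cos(πx/2))` (with
`φ0'(x) = tan(πx/2)` and `φ0''(x) = (π/2)(1 + tan²(πx/2))`). -/
theorem stmt_18 (u0 : ℝ → ℝ)
    (hu0C1 : ContDiffOn ℝ 1 u0 (Set.Icc (-1 : ℝ) 1))
    (hu0ge : ∀ x ∈ Set.Icc (-1 : ℝ) 1, 1 ≤ u0 x)
    (hbcp : derivWithin u0 (Set.Icc (-1 : ℝ) 1) 1 = u0 1)
    (hbcm : derivWithin u0 (Set.Icc (-1 : ℝ) 1) (-1) = -u0 (-1))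
    (u : ℝ → ℝ → ℝ) (hu : IsGlobalSolB u u0)
    (φ0 : ℝ → ℝ) (hφ0 : ∀ x : ℝ, φ0 x = -(2 / π) * Real.log (Real.cos (π * x / 2))) :
    (∀ M : ℝ, ∃ T : ℝ, ∀ t ≥ T, ∀ x ∈ Set.Icc (-1 : ℝ) 1, M ≤ u x t) ∧
    (∀ K : Set (ℝ × ℝ), IsCompact K → K ⊆ Set.Ioo (-1 : ℝ) 1 ×ˢ (Set.univ : Set ℝ) →
      TendstoUniformlyOn (fun s (p : ℝ × ℝ) => u p.1 (p.2 + s) - u 0 s)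
        (fun p => φ0 p.1 + (π / 2) * p.2) Filter.atTop K ∧
      TendstoUniformlyOn (fun s (p : ℝ × ℝ) => ux u p.1 (p.2 + s))
        (fun p => Real.tan (π * p.1 / 2)) Filter.atTop K ∧
      TendstoUniformlyOn (fun s (p : ℝ × ℝ) => uxx u p.1 (p.2 + s))
        (fun p => (π / 2) * (1 + Real.tan (π * p.1 / 2) ^ 2)) Filter.atTop K ∧
      TendstoUniformlyOn (fun s (p : ℝ × ℝ) => ut u p.1 (p.2 + s))
        (fun _ => π / 2) Filter.atTop K) := by
  have S := Sol.of hu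
  have hpi := Real.pi_pos
  have h0 : ∀ x ∈ Icc (-1:ℝ) 1, 1 ≤ u x 0 := fun x hx => by
    rw [hu.2.2.2.2 x hx]; exact hu0ge x hx
  have hut : ∀ t > (0:ℝ), ∀ x ∈ Ioo (-1:ℝ) 1, ut u x t = uxx u x t / (1 + ux u x t^2) := fun t ht x hx =>
    (hu.2.2.1 t ht x hx).2.2.2
  constructor
  · intro M
    refine ⟨max 0 (5/2*M), fun t ht x hx => ?_⟩
    have h1 := S.growth h0 x hx t ((le_max_left _ _).trans ht)
    have h2 := (le_max_right 0 (5/2*M)).trans ht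
    linarith
  intro K hK hKs
  obtain ⟨r, hr0, hr1, L, hL, hbox⟩ := compact_box hK hKs
  have hIo : ∀ x ∈ Icc (-r) r, x ∈ Ioo (-1:ℝ) 1 := fun x hx => ⟨by linarith [hx.1], by linarith [hx.2]⟩
  have h0r : (0:ℝ) ∈ Icc (-r) r := ⟨by linarith, hr0⟩
  refine ⟨?_, ?_, ?_, ?_⟩
  · rw [Metric.tendstoUniformlyOn_iff]
    intro ε hε
    obtain ⟨η, hηe⟩ : ∃ η, η = ε/(3+L) := ⟨_, rfl⟩
    have hη : 0 < η := by rw [hηe]; positivity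
    have hηL : η*(3+L) = ε := by rw [hηe]; field_simp
    obtain ⟨T1, hT1⟩ := S.conv_a h0 hr0 hr1 hη
    obtain ⟨T2, hT20, hT2⟩ := S.conv_c0 h0 hr0 hr1 hη
    filter_upwards [eventually_ge_atTop (max T1 T2 + L)] with s hs z hz
    obtain ⟨hx, ht⟩ := hbox z hz
    obtain ⟨x, t⟩ := z
    simp only at hx ht ⊢
    have ht' := abs_le.1 ht
    have hT1' := le_max_left T1 T2
    have hT2' := le_max_right T1 T2
    have hts : 0 ≤ t + s := by linarith
    have hs0 : 0 ≤ s := by linarith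
    have a1 := abs_le.1 (hT1 (t+s) (by linarith) x hx)
    have a2 := abs_le.1 (hT1 (t+s) (by linarith) 0 h0r)
    rw [xt_eq (Ioo_subset_Icc_self (hIo x hx)) hts] at a1
    rw [xt_eq (Ioo_subset_Icc_self (hIo 0 h0r)) hts, ph_zero] at a2
    have hph : φ0 x = ph x := hφ0 x
    have key : |u 0 (t+s) - u 0 s - π/2*t| ≤ η*L := by
      rcases lt_trichotomy t 0 with h | h | h
      · have b := abs_le.1 (hT2 (t+s) (by linarith) 0 h0r (-t) (by linarith))
        rw [add_neg_cancel_comm, xt_eq (Ioo_subset_Icc_self (hIo 0 h0r)) hts,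
          xt_eq (Ioo_subset_Icc_self (hIo 0 h0r)) hs0] at b
        have c : (u 0 s - u 0 (t+s))/(-t) * (-t) = u 0 s - u 0 (t+s) := by
          have : t ≠ 0 := h.ne
          field_simp
        generalize (u 0 s - u 0 (t+s))/(-t) = D at *
        rw [abs_le]; constructor <;> nlinarith
      · subst h; simp; positivity
      · have b := abs_le.1 (hT2 s (by linarith) 0 h0r t h)
        rw [add_comm s t, xt_eq (Ioo_subset_Icc_self (hIo 0 h0r)) hts,
          xt_eq (Ioo_subset_Icc_self (hIo 0 h0r)) hs0] at b
        have c : (u 0 (t+s) - u 0 s)/t * t = u 0 (t+s) - u 0 s := by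
          field_simp
        generalize (u 0 (t+s) - u 0 s)/t = D at *
        rw [abs_le]; constructor <;> nlinarith
    have key' := abs_le.1 key
    rw [Real.dist_eq, abs_lt, hph]
    constructor <;> linarith [a1.1, a1.2, a2.1, a2.2, key'.1, key'.2]
  · rw [Metric.tendstoUniformlyOn_iff]
    intro ε hε
    obtain ⟨T1, hT1⟩ := S.conv_b h0 hr0 hr1 (half_pos hε)
    filter_upwards [eventually_ge_atTop (T1 + L)] with s hs z hz
    obtain ⟨hx, ht⟩ := hbox z hz
    have ht' := abs_le.1 ht
    have := hT1 (z.2+s) (by linarith) z.1 hx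
    rw [dist_comm, Real.dist_eq]; linarith
  · rw [Metric.tendstoUniformlyOn_iff]
    intro ε hε
    obtain ⟨M, hM, hMb⟩ := tan_bd hr1
    obtain ⟨B, hB⟩ : ∃ B, B = (1+(M+1)^2) + π/2*(2*M+1) := ⟨_, rfl⟩
    have hB0 : 0 < B := by rw [hB]; positivity
    obtain ⟨η, hηe⟩ : ∃ η, η = min 1 (ε/(2*B)) := ⟨_, rfl⟩
    have hη : 0 < η := by rw [hηe]; exact lt_min one_pos (by positivity)
    have hη1 : η ≤ 1 := by rw [hηe]; exact min_le_left _ _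
    have hηB : η*B < ε := by
      have : η ≤ ε/(2*B) := by rw [hηe]; exact min_le_right _ _
      rw [le_div_iff₀ (by positivity)] at this
      nlinarith
    obtain ⟨T1, hT1⟩ := S.conv_b h0 hr0 hr1 hη
    obtain ⟨T2, hT20, hT2⟩ := S.conv_c h0 hr0 hr1 hη
    filter_upwards [eventually_ge_atTop (max T1 T2 + L)] with s hs z hz
    obtain ⟨hx, ht⟩ := hbox z hz
    obtain ⟨x, t⟩ := z
    simp only at hx ht ⊢
    have ht' := abs_le.1 ht
    have hT1' := le_max_left T1 T2
    have hT2' := le_max_right T1 T2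
    have a1 := hT1 (t+s) (by linarith) x hx
    have a2 := hT2 (t+s) (by linarith) x hx
    have a3 := hMb x hx
    have hD : uxx u x (t+s) = uxx u x (t+s) / (1 + ux u x (t+s)^2) * (1 + ux u x (t+s)^2) := by
      have : (1 + ux u x (t+s)^2) ≠ 0 := by positivity
      field_simp
    rw [dist_comm, Real.dist_eq, hD]
    generalize uxx u x (t+s) / (1 + ux u x (t+s)^2) = D at *
    generalize ux u x (t+s) = p at *
    generalize Real.tan (π*x/2) = P at *
    have e1 : D*(1+p^2) - π/2*(1+P^2) = (D - π/2)*(1+p^2) + π/2*((p-P)*(p+P)) := by ring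
    have hP' := abs_le.1 a3
    have hp' := abs_le.1 a1
    have c1 : |(D - π/2)*(1+p^2)| ≤ η*(1+(M+1)^2) := by
      rw [abs_mul, abs_of_pos (show 0 < 1+p^2 by positivity)]
      have : p^2 ≤ (M+1)^2 := sq_le_sq' (by linarith) (by linarith)
      exact mul_le_mul a2 (by linarith) (by positivity) hη.le
    have c2 : |π/2*((p-P)*(p+P))| ≤ π/2*(η*(2*M+1)) := by
      rw [abs_mul, abs_mul, abs_of_pos (show 0 < π/2 by positivity)]
      have : |p+P| ≤ 2*M+1 := by rw [abs_le]; constructor <;> linarith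
      exact mul_le_mul_of_nonneg_left (mul_le_mul a1 this (abs_nonneg _) hη.le) (by positivity)
    rw [e1]
    calc _ ≤ _ := abs_add_le _ _
      _ ≤ η*(1+(M+1)^2) + π/2*(η*(2*M+1)) := add_le_add c1 c2
      _ = η*B := by rw [hB]; ring
      _ < ε := hηB
  · rw [Metric.tendstoUniformlyOn_iff]
    intro ε hε
    obtain ⟨T1, hT10, hT1⟩ := S.conv_c h0 hr0 hr1 (half_pos hε)
    filter_upwards [eventually_ge_atTop (T1 + L)] with s hs z hz
    obtain ⟨hx, ht⟩ := hbox z hz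
    have ht' := abs_le.1 ht
    have := hT1 (z.2+s) (by linarith) z.1 hx
    rw [dist_comm, Real.dist_eq, hut (z.2+s) (by linarith) z.1 (hIo _ hx)]; linarith
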